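/- arXiv:2508.04496 — 5 statements merged into one kernel-verified Lean document; each statement's English description precedes it below -/
import Mathlib

section
/- Let Ω be a bounded domain in the complex plane ℂ, let B ⊂ ℂ be closed with B ∩ Ω nonempty, and let A ⊂ Ω be a compact subset of a Lipschitz curve. Let f be an analytic function on Ω ∖ B. If for some b > 0 and C > 0, |f(z)| ≤ C·dist(z, A ∪ B)^{−b} for all z ∈ Ω ∖ (A ∪ B), then there is a constant C₁ > 0 such that |f(z)| ≤ C₁·dist(z,B)^{−b} for all z ∈ Ω ∖ B. -/
open MeasureTheory Metric Set Filter

noncomputable section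

/-- A compact set A ⊂ ℂ ≅ ℝ² is a Lipschitz curve if near any of its points it is a rotated
graph of a Lipschitz function of one variable. -/
def IsLipschitzCurveC (A : Set ℂ) : Prop :=
  IsCompact A ∧ ∃ L R : ℝ, 0 < L ∧ 0 < R ∧ ∀ a ∈ A,
    ∃ φ : ℝ → ℝ,
      (∀ s ∈ Metric.ball (0 : ℝ) R, ∀ t ∈ Metric.ball (0 : ℝ) R, |φ s - φ t| ≤ L * |s - t|) ∧
      ∃ U : ℂ ≃ₗᵢ[ℝ] ℂ,
        {z : ℂ | |z.re| < R ∧ |z.im| < 3 * L * R} ∩ (U '' ((· - a) '' A)) =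
          {z : ℂ | |z.re| < R ∧ z.im = φ z.re}

/-- The distance of a point of the local chart to the curve controls the vertical distance. -/
lemma graph_dist (Γ : Set ℂ) (a : ℂ) (L R r : ℝ) (hL : 0 < L) (hr : 0 < r)
    (h1 : (4 * L + 3) * r ≤ R) (h2 : (6 * L + 2) * r ≤ 3 * L * R)
    (φ : ℝ → ℝ)
    (hφ : ∀ s ∈ Metric.ball (0 : ℝ) R, ∀ t ∈ Metric.ball (0 : ℝ) R, |φ s - φ t| ≤ L * |s - t|)
    (hφ0 : φ 0 = 0)
    (U : ℂ ≃ₗᵢ[ℝ] ℂ)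
    (hU : {z : ℂ | |z.re| < R ∧ |z.im| < 3 * L * R} ∩ (U '' ((· - a) '' Γ)) =
          {z : ℂ | |z.re| < R ∧ z.im = φ z.re})
    (w : ℂ) (hre : |(U (w - a)).re| ≤ 2 * r) (him : |(U (w - a)).im| ≤ (2 * L + 1) * r)
    (γ : ℂ) (hγ : γ ∈ Γ) :
    |(U (w - a)).im - φ (U (w - a)).re| ≤ (1 + L) * dist w γ := by
  have hd : dist w γ = ‖U (w - a) - U (γ - a)‖ := by
    rw [← map_sub, U.norm_map, dist_eq_norm]; congr 1; ring
  have hq : U (γ - a) ∈ U '' ((· - a) '' Γ) := ⟨_, ⟨γ, hγ, rfl⟩, rfl⟩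
  rw [hd]
  set p := U (w - a)
  set q := U (γ - a)
  have e1 : |p.re - q.re| ≤ ‖p - q‖ := by simpa using Complex.abs_re_le_norm (p - q)
  have e2 : |p.im - q.im| ≤ ‖p - q‖ := by simpa using Complex.abs_im_le_norm (p - q)
  have hLr : 0 < L * r := mul_pos hL hr
  have hpR : |p.re| < R := by nlinarith
  have hR : 0 < R := by nlinarith
  have hφp : |φ p.re| ≤ L * (2 * r) := by
    have := hφ p.re (by simpa using hpR) 0 (by simpa using hR)
    rw [hφ0] at this
    simp only [sub_zero] at this
    nlinarith
  have hbd : |p.im - φ p.re| ≤ (4 * L + 1) * r := by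
    have := abs_sub p.im (φ p.re)
    nlinarith
  by_cases hc : |q.re| < R ∧ |q.im| < 3 * L * R
  · have hm : q ∈ {z : ℂ | |z.re| < R ∧ z.im = φ z.re} := by
      rw [← hU]; exact ⟨hc, hq⟩
    have h3 := hφ q.re (by simpa using hc.1) p.re (by simpa using hpR)
    have h4 : q.im = φ q.re := hm.2
    have h5 : |p.im - φ p.re| ≤ |p.im - q.im| + |φ q.re - φ p.re| := by
      rw [← h4]; exact abs_sub_le _ _ _
    rw [abs_sub_comm q.re] at h3
    nlinarith
  · have : (4 * L + 1) * r ≤ ‖p - q‖ := by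
      by_cases hc1 : |q.re| < R
      · have hc2 : 3 * L * R ≤ |q.im| := by
          by_contra hh; exact hc ⟨hc1, not_le.1 hh⟩
        have := abs_sub_abs_le_abs_sub q.im p.im
        rw [abs_sub_comm] at this
        nlinarith
      · have := abs_sub_abs_le_abs_sub q.re p.re
        rw [abs_sub_comm] at this
        nlinarith
    nlinarith [norm_nonneg (p - q)]

/-- Product estimate on the boundary. -/
lemma weight_est (F C H r b m x : ℝ) (N : ℕ) (hN : b ≤ N) (hb : 0 < b) (hC : 0 < C)
    (hH : 1 ≤ H) (hr : 0 < r) (hm : 0 ≤ m) (hmH : m ≤ H * r) (hx : 0 ≤ x) (hxH : x ≤ H * r)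
    (hF0 : 0 ≤ F)
    (hF : 0 < m → F ≤ C * (m / H ^ 2) ^ (-b)) (hNpos : N ≠ 0) :
    F * (m * x) ^ N ≤ C * (1 / H ^ 2) ^ (-b) * (H * r) ^ (-b) * (H * r) ^ (2 * N) := by
  have hHr : 0 < H * r := by positivity
  rcases hm.eq_or_lt with h0 | h0
  · rw [← h0]
    simp only [zero_mul, zero_pow hNpos, mul_zero]
    positivity
  · have e0 : (m / H ^ 2) ^ (-b) = (1 / H ^ 2) ^ (-b) * m ^ (-b) := by
      rw [← Real.mul_rpow (by positivity) hm]; congr 1; ring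
    have e1 : m ^ (-b) * m ^ N ≤ (H * r) ^ (-b) * (H * r) ^ N := by
      rw [← Real.rpow_natCast, ← Real.rpow_natCast, ← Real.rpow_add h0, ← Real.rpow_add hHr]
      exact Real.rpow_le_rpow hm hmH (by linarith)
    have e2 : x ^ N ≤ (H * r) ^ N := pow_le_pow_left₀ hx hxH N
    calc F * (m * x) ^ N ≤ (C * (m / H ^ 2) ^ (-b)) * (m * x) ^ N := by
          gcongr; exact hF h0
      _ = C * (1 / H ^ 2) ^ (-b) * (m ^ (-b) * m ^ N) * x ^ N := by rw [e0, mul_pow]; ring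
      _ ≤ C * (1 / H ^ 2) ^ (-b) * ((H * r) ^ (-b) * (H * r) ^ N) * (H * r) ^ N := by
          gcongr
      _ = _ := by ring

lemma near_curve (Ω : Set ℂ) (B : Set ℂ) (hBne : B.Nonempty)
    (Γ : Set ℂ) (A : Set ℂ) (hAΓ : A ⊆ Γ)
    (f : ℂ → ℂ) (hf : AnalyticOnNhd ℂ f (Ω \ B))
    (b C : ℝ) (hb : 0 < b) (hC : 0 < C)
    (hbound : ∀ z ∈ Ω \ (A ∪ B), ‖f z‖ ≤ C * Metric.infDist z (A ∪ B) ^ (-b))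
    (L R r : ℝ) (hL : 0 < L) (hr : 0 < r)
    (h1 : (4 * L + 3) * r ≤ R) (h2 : (6 * L + 2) * r ≤ 3 * L * R)
    (a : ℂ) (haA : a ∈ A) (φ : ℝ → ℝ)
    (hφ : ∀ s ∈ Metric.ball (0 : ℝ) R, ∀ t ∈ Metric.ball (0 : ℝ) R, |φ s - φ t| ≤ L * |s - t|)
    (U : ℂ ≃ₗᵢ[ℝ] ℂ)
    (hU : {z : ℂ | |z.re| < R ∧ |z.im| < 3 * L * R} ∩ (U '' ((· - a) '' Γ)) =
          {z : ℂ | |z.re| < R ∧ z.im = φ z.re})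
    (z : ℂ) (hza : dist z a < r) (hzB : (2 * L + 5) * r ≤ Metric.infDist z B)
    (hΩ : Metric.closedBall a ((2 * L + 3) * r) ⊆ Ω) (N : ℕ) (hN : b ≤ N) :
    ‖f z‖ ≤ C * (1 / (4 * L + 5) ^ 2) ^ (-b) * ((4 * L + 5)) ^ (-b) * (4 * L + 5) ^ (2 * N)
      * r ^ (-b) := by
  have hLr : 0 < L * r := mul_pos hL hr
  have hR : 0 < R := by nlinarith
  have hNpos : N ≠ 0 := by rintro rfl; simp at hN; linarith
  have hφ0 : φ 0 = 0 := by
    have : (0 : ℂ) ∈ {z : ℂ | |z.re| < R ∧ z.im = φ z.re} := by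
      rw [← hU]
      refine ⟨⟨by simpa using hR, by simp; positivity⟩, 0, ⟨a, hAΓ haA, by simp⟩, by simp⟩
    simpa using this.2.symm
  have key := graph_dist Γ a L R r hL hr h1 h2 φ hφ hφ0 U hU
  have hφb : ∀ u : ℝ, |u| ≤ 2 * r → |φ u| ≤ L * (2 * r) := by
    intro u hu
    have := hφ u (by simp; nlinarith) 0 (by simpa using hR)
    rw [hφ0] at this
    simp only [sub_zero] at this
    nlinarith
  set H : ℝ := 4 * L + 5 with hH
  set q1 : ℂ := ⟨2 * r, φ (2 * r)⟩ with hq1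
  set q2 : ℂ := ⟨-(2 * r), φ (-(2 * r))⟩ with hq2
  set w1 : ℂ := a + U.symm q1 with hw1
  set w2 : ℂ := a + U.symm q2 with hw2
  have hn1 : ∀ w, ‖w - w1‖ = ‖U (w - a) - q1‖ := by
    intro w
    rw [← U.norm_map (w - w1), hw1, ← sub_sub, map_sub, U.apply_symm_apply]
  have hn2 : ∀ w, ‖w - w2‖ = ‖U (w - a) - q2‖ := by
    intro w
    rw [← U.norm_map (w - w2), hw2, ← sub_sub, map_sub, U.apply_symm_apply]
  set Q : Set ℂ := {w | |(U (w - a)).re| < 2 * r ∧ |(U (w - a)).im| < (2 * L + 1) * r} with hQ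
  set K : Set ℂ := {w | |(U (w - a)).re| ≤ 2 * r ∧ |(U (w - a)).im| ≤ (2 * L + 1) * r} with hK
  have hcU : Continuous fun w => U (w - a) := U.continuous.comp (by fun_prop)
  have hcre : Continuous fun w => |(U (w - a)).re| := (Complex.continuous_re.comp hcU).abs
  have hcim : Continuous fun w => |(U (w - a)).im| := (Complex.continuous_im.comp hcU).abs
  have hQo : IsOpen Q := (isOpen_lt hcre continuous_const).inter (isOpen_lt hcim continuous_const)
  have hKc : IsClosed K :=
    (isClosed_le hcre continuous_const).inter (isClosed_le hcim continuous_const)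
  have hQK : closure Q ⊆ K := closure_minimal (fun w hw => ⟨hw.1.le, hw.2.le⟩) hKc
  have hKball : K ⊆ closedBall a ((2 * L + 3) * r) := by
    intro w hw
    rw [mem_closedBall, dist_eq_norm, ← U.norm_map]
    have := Complex.norm_le_abs_re_add_abs_im (U (w - a))
    linarith [hw.1, hw.2]
  have hQb : Bornology.IsBounded Q :=
    isBounded_closedBall.subset ((subset_closure.trans hQK).trans hKball)
  have hdB : ∀ w ∈ K, r ≤ infDist w B := by
    intro w hw
    have e1 : dist w a ≤ _ := hKball hw
    have e2 := infDist_le_infDist_add_dist (s := B) (x := z) (y := w)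
    have e3 := dist_triangle_right z w a
    nlinarith
  have hKΩ : K ⊆ Ω \ B := by
    intro w hw
    refine ⟨hΩ (hKball hw), fun hwB => ?_⟩
    have := hdB w hw
    rw [infDist_zero_of_mem hwB] at this
    linarith
  -- size of the weights
  have hs : ∀ p q : ℂ, |p.re| ≤ 2 * r → |p.im| ≤ (2 * L + 1) * r → |q.re| ≤ 2 * r →
      |q.im| ≤ L * (2 * r) → ‖p - q‖ ≤ H * r := by
    intro p q i1 i2 i3 i4
    have := Complex.norm_le_abs_re_add_abs_im (p - q)
    rw [Complex.sub_re, Complex.sub_im] at this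
    have := abs_sub p.re q.re
    have := abs_sub p.im q.im
    rw [hH]
    nlinarith
  have h2r : |2 * r| ≤ 2 * r := (abs_of_pos (by linarith)).le
  have h2r' : |-(2 * r)| ≤ 2 * r := by rw [abs_neg]; exact h2r
  have hs1 : ∀ w ∈ K, ‖w - w1‖ ≤ H * r := by
    intro w hw
    rw [hn1]; exact hs _ _ hw.1 hw.2 h2r (hφb _ h2r)
  have hs2 : ∀ w ∈ K, ‖w - w2‖ ≤ H * r := by
    intro w hw
    rw [hn2]; exact hs _ _ hw.1 hw.2 h2r' (hφb _ h2r')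
  have hH1 : 1 ≤ H := by rw [hH]; linarith
  have hHL : 1 + L ≤ H := by rw [hH]; linarith
  -- f bound from a lower bound of the distance
  have hfb : ∀ w ∈ K, ∀ m : ℝ, 0 < m → m ≤ H * r →
      m ≤ H * |(U (w - a)).im - φ (U (w - a)).re| → ‖f w‖ ≤ C * (m / H ^ 2) ^ (-b) := by
    intro w hw m hm hmH hmv
    have hpos : 0 < m / H ^ 2 := by positivity
    have hl : m / H ^ 2 ≤ infDist w (A ∪ B) := by
      refine (le_infDist (hBne.mono subset_union_right)).2 ?_
      rintro y (hy | hy)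
      · have := key w hw.1 hw.2 y (hAΓ hy)
        rw [div_le_iff₀ (by positivity)]
        have h3 : (1 + L) * dist w y ≤ H * dist w y := by gcongr
        calc m ≤ H * (H * dist w y) := hmv.trans (by gcongr; linarith)
          _ = _ := by ring
      · have h3 := (hdB w hw).trans (infDist_le_dist_of_mem hy)
        refine le_trans ?_ h3
        rw [div_le_iff₀ (by positivity)]
        nlinarith
    have hwA : w ∉ A ∪ B := by
      intro hmem
      rw [infDist_zero_of_mem hmem] at hl
      linarith
    refine (hbound w ⟨(hKΩ hw).1, hwA⟩).trans ?_
    gcongr C * ?_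
    exact Real.rpow_le_rpow_of_nonpos hpos hl (by linarith)
  set M := C * (1 / H ^ 2) ^ (-b) * (H * r) ^ (-b) * (H * r) ^ (2 * N) with hM
  have hmax : ‖f z * ((z - w1) * (z - w2)) ^ N‖ ≤ M := by
    refine Complex.norm_le_of_forall_mem_frontier_norm_le
      (f := fun w => f w * ((w - w1) * (w - w2)) ^ N) hQb ?_ ?_ ?_
    · apply DifferentiableOn.diffContOnCl
      intro w hw
      have := (hf w (hKΩ (hQK hw))).differentiableAt
      apply DifferentiableAt.differentiableWithinAt
      fun_prop
    · intro w hw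
      have hwK : w ∈ K := hQK hw.1
      have hwQ : w ∉ Q := by rw [← hQo.interior_eq]; exact hw.2
      rw [norm_mul, norm_pow, norm_mul]
      by_cases hcase : |(U (w - a)).im| < (2 * L + 1) * r
      · have hre : |(U (w - a)).re| = 2 * r :=
          le_antisymm hwK.1 (by by_contra hh; exact hwQ ⟨not_le.1 hh, hcase⟩)
        rcases (abs_eq (by linarith)).1 hre with hre | hre
        · have he : ‖w - w1‖ = |(U (w - a)).im - φ (U (w - a)).re| := by
            rw [hn1, Complex.norm_eq_sqrt_sq_add_sq]
            simp [-map_sub, hq1, hre, Real.sqrt_sq_eq_abs]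
          refine weight_est _ C H r b _ _ N hN hb hC hH1 hr (norm_nonneg _) (hs1 w hwK)
            (norm_nonneg _) (hs2 w hwK) (norm_nonneg _) (fun hm => ?_) hNpos
          refine hfb w hwK _ hm (hs1 w hwK) ?_
          rw [← he]; nlinarith
        · have he : ‖w - w2‖ = |(U (w - a)).im - φ (U (w - a)).re| := by
            rw [hn2, Complex.norm_eq_sqrt_sq_add_sq]
            simp [-map_sub, hq2, hre, Real.sqrt_sq_eq_abs]
          rw [mul_comm ‖w - w1‖]
          refine weight_est _ C H r b _ _ N hN hb hC hH1 hr (norm_nonneg _) (hs2 w hwK)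
            (norm_nonneg _) (hs1 w hwK) (norm_nonneg _) (fun hm => ?_) hNpos
          refine hfb w hwK _ hm (hs2 w hwK) ?_
          rw [← he]; nlinarith
      · refine weight_est _ C H r b _ _ N hN hb hC hH1 hr (norm_nonneg _) (hs1 w hwK)
            (norm_nonneg _) (hs2 w hwK) (norm_nonneg _) (fun hm => ?_) hNpos
        refine hfb w hwK _ hm (hs1 w hwK) ((hs1 w hwK).trans ?_)
        have := abs_sub_abs_le_abs_sub (U (w - a)).im (φ (U (w - a)).re)
        have := hφb _ hwK.1
        gcongr
        linarith
    · apply subset_closure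
      have e := dist_eq_norm z a
      rw [← U.norm_map] at e
      have e1 := Complex.abs_re_le_norm (U (z - a))
      have e2 := Complex.abs_im_le_norm (U (z - a))
      exact ⟨by linarith, by nlinarith⟩
  have hr1 : r ≤ ‖z - w1‖ := by
    have e := dist_eq_norm z a
    rw [← U.norm_map] at e
    have e1 := Complex.abs_re_le_norm (U (z - a))
    have e2 := Complex.abs_re_le_norm (U (z - a) - q1)
    rw [hn1]
    simp only [Complex.sub_re, hq1] at e2 ⊢
    have := neg_abs_le ((U (z - a)).re - 2 * r)
    have := le_abs_self (U (z - a)).re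
    linarith
  have hr2 : r ≤ ‖z - w2‖ := by
    have e := dist_eq_norm z a
    rw [← U.norm_map] at e
    have e1 := Complex.abs_re_le_norm (U (z - a))
    have e2 := Complex.abs_re_le_norm (U (z - a) - q2)
    rw [hn2]
    simp only [Complex.sub_re, hq2] at e2 ⊢
    have := le_abs_self ((U (z - a)).re - -(2 * r))
    have := neg_abs_le (U (z - a)).re
    linarith
  have hfin : ‖f z‖ * r ^ (2 * N) ≤ M := by
    refine le_trans ?_ hmax
    rw [norm_mul, norm_pow, norm_mul, pow_mul, sq]
    gcongr
  have hMe : M = (C * (1 / H ^ 2) ^ (-b) * H ^ (-b) * H ^ (2 * N) * r ^ (-b)) * r ^ (2 * N) := by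
    rw [hM, Real.mul_rpow (by linarith) hr.le, mul_pow]; ring
  rw [hMe] at hfin
  exact le_of_mul_le_mul_right hfin (by positivity)

/-- Corollary 2.9(1): power-type estimate for analytic functions near a
Lipschitz curve in the plane. -/
theorem stmt_6 (Ω : Set ℂ) (hΩo : IsOpen Ω) (hΩc : IsConnected Ω)
    (hΩb : Bornology.IsBounded Ω)
    (B : Set ℂ) (hB : IsClosed B) (hBΩ : (B ∩ Ω).Nonempty)
    (Γ : Set ℂ) (hΓ : IsLipschitzCurveC Γ)
    (A : Set ℂ) (hA : IsCompact A) (hAΓ : A ⊆ Γ) (hAΩ : A ⊆ Ω)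
    (f : ℂ → ℂ) (hf : AnalyticOnNhd ℂ f (Ω \ B))
    (b C : ℝ) (hb : 0 < b) (hC : 0 < C)
    (hbound : ∀ z ∈ Ω \ (A ∪ B), ‖f z‖ ≤ C * Metric.infDist z (A ∪ B) ^ (-b)) :
    ∃ C₁ : ℝ, 0 < C₁ ∧ ∀ z ∈ Ω \ B, ‖f z‖ ≤ C₁ * Metric.infDist z B ^ (-b) := by
  obtain ⟨-, L, R, hL, hR, hloc⟩ := hΓ
  obtain ⟨δ, hδ, hδΩ⟩ := hA.exists_cthickening_subset_open hΩo hAΩ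
  obtain ⟨x0, hx0B, hx0Ω⟩ := hBΩ
  have hBne : B.Nonempty := ⟨x0, hx0B⟩
  obtain ⟨D0, hD0⟩ := isBounded_iff.1 hΩb
  set D := max D0 1 with hD
  have hDpos : 0 < D := lt_of_lt_of_le one_pos (le_max_right _ _)
  obtain ⟨N, hN⟩ := exists_nat_ge b
  obtain ⟨c, hc, hc1, hc2, hc3, hc4⟩ : ∃ c : ℝ, 0 < c ∧ (4 * L + 3) * (c * D) ≤ R ∧
      (6 * L + 2) * (c * D) ≤ 3 * L * R ∧ (2 * L + 5) * c ≤ 1 ∧ (2 * L + 3) * (c * D) ≤ δ := by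
    refine ⟨min (min (R / ((4 * L + 3) * D)) (3 * L * R / ((6 * L + 2) * D)))
      (min (1 / (2 * L + 5)) (δ / ((2 * L + 3) * D))), by positivity, ?_, ?_, ?_, ?_⟩
    · have := (min_le_left _ (min (1 / (2 * L + 5)) (δ / ((2 * L + 3) * D)))).trans
        (min_le_left (R / ((4 * L + 3) * D)) (3 * L * R / ((6 * L + 2) * D)))
      rw [le_div_iff₀ (by positivity)] at this
      linarith
    · have := (min_le_left _ (min (1 / (2 * L + 5)) (δ / ((2 * L + 3) * D)))).trans
        (min_le_right (R / ((4 * L + 3) * D)) (3 * L * R / ((6 * L + 2) * D)))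
      rw [le_div_iff₀ (by positivity)] at this
      linarith
    · have := (min_le_right (min (R / ((4 * L + 3) * D)) (3 * L * R / ((6 * L + 2) * D))) _).trans
        (min_le_left (1 / (2 * L + 5)) (δ / ((2 * L + 3) * D)))
      rw [le_div_iff₀ (by positivity)] at this
      linarith
    · have := (min_le_right (min (R / ((4 * L + 3) * D)) (3 * L * R / ((6 * L + 2) * D))) _).trans
        (min_le_right (1 / (2 * L + 5)) (δ / ((2 * L + 3) * D)))
      rw [le_div_iff₀ (by positivity)] at this
      linarith
  set E := C * (1 / (4 * L + 5) ^ 2) ^ (-b) * ((4 * L + 5)) ^ (-b) * (4 * L + 5) ^ (2 * N) with hE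
  have hEpos : 0 < E := by positivity
  refine ⟨(E + C) * c ^ (-b), by positivity, ?_⟩
  intro z hz
  set d := infDist z B with hd
  have hdpos : 0 < d := (hB.notMem_iff_infDist_pos hBne).1 hz.2
  have hdD : d ≤ D := (infDist_le_dist_of_mem hx0B).trans
    ((hD0 hz.1 hx0Ω).trans (le_max_left _ _))
  have hcd : 0 < c * d := by positivity
  have hcdD : c * d ≤ c * D := by gcongr
  have hsplit : (E + C) * c ^ (-b) * d ^ (-b) = E * (c * d) ^ (-b) + C * (c * d) ^ (-b) := by
    rw [Real.mul_rpow hc.le hdpos.le]; ring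
  have hp : 0 < (c * d) ^ (-b) := by positivity
  rw [hsplit]
  by_cases hnear : ∃ a ∈ A, dist z a < c * d
  · obtain ⟨a, haA, hza⟩ := hnear
    obtain ⟨φ, hφ, U, hU⟩ := hloc a (hAΓ haA)
    have := near_curve Ω B hBne Γ A hAΓ f hf b C hb hC hbound L R (c * d) hL hcd
      (le_trans (by gcongr) hc1) (le_trans (by gcongr) hc2) a haA φ hφ U hU z hza
      (by nlinarith) ?_ N hN
    · have h3 : 0 < C * (c * d) ^ (-b) := by positivity
      linarith
    · refine Subset.trans ?_ hδΩ
      refine Subset.trans ?_ (closedBall_subset_cthickening haA δ)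
      exact closedBall_subset_closedBall (le_trans (by gcongr) hc4)
  · push Not at hnear
    have hl : c * d ≤ infDist z (A ∪ B) := by
      refine (le_infDist (hBne.mono subset_union_right)).2 ?_
      rintro y (hy | hy)
      · exact hnear y hy
      · have := infDist_le_dist_of_mem (x := z) hy
        nlinarith
    have hzA : z ∉ A ∪ B := by
      intro hmem
      rw [infDist_zero_of_mem hmem] at hl
      linarith
    have h4 := hbound z ⟨hz.1, hzA⟩
    have h5 : C * infDist z (A ∪ B) ^ (-b) ≤ C * (c * d) ^ (-b) := by
      gcongr C * ?_
      exact Real.rpow_le_rpow_of_nonpos hcd hl (by linarith)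
    have h6 : 0 < E * (c * d) ^ (-b) := by positivity
    linarith
end
end

section
/- Let Ω be a bounded domain in the complex plane ℂ, let B ⊂ ℂ be closed with B ∩ Ω nonempty, and let A ⊂ Ω be a compact subset of a Lipschitz curve. Let f be an analytic function on Ω ∖ B. If for some a > 0, b > 0 and α ∈ (0,1), |f(z)| ≤ a·(log(1/dist(z, A ∪ B)))^b for all z ∈ Ω ∖ (A ∪ B) with dist(z, A ∪ B) < α, then there are constants ε and τ with ε > τ > 0 such that |f(z)| ≤ a·(log(ε/dist(z,B)))^b for all z ∈ Ω ∖ B with dist(z,B) < τ. -/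
open MeasureTheory Metric Set Filter

noncomputable section

lemma circ_sub {f : ℂ → ℂ} {c : ℂ} {R p : ℝ} (hR : 0 < R) (hp : 0 < p)
    (hf : AnalyticOnNhd ℂ f (closedBall c R)) :
    CircleIntegrable (fun w => ‖f w‖ ^ p) c R ∧
    ‖f c‖ ^ p ≤ Real.circleAverage (fun w => ‖f w‖ ^ p) c R := by
  have hint : CircleIntegrable (fun w => ‖f w‖ ^ p) c R := by
    apply ContinuousOn.circleIntegrable hR.le
    refine ContinuousOn.rpow_const ?_ (fun _ _ => Or.inr hp.le)
    exact (hf.continuousOn.mono sphere_subset_closedBall).norm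
  refine ⟨hint, ?_⟩
  have habs : |R| = R := abs_of_pos hR
  by_cases h0 : f c = 0
  · rw [h0, norm_zero, Real.zero_rpow hp.ne']
    apply Real.circleAverage_nonneg_of_nonneg
    intro x _
    positivity
  have hf' : AnalyticOnNhd ℂ f (closedBall c |R|) := by rwa [habs]
  have hJ : Real.log ‖f c‖ ≤ Real.circleAverage (Real.log ‖f ·‖) c R := by
    rw [hf'.circleAverage_log_norm hR.ne' h0]
    have : 0 ≤ ∑ᶠ u, MeromorphicOn.divisor f (closedBall c |R|) u * Real.log (R * ‖c - u‖⁻¹) := by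
      apply finsum_nonneg
      intro u
      by_cases hu : u ∈ closedBall c |R|
      · apply mul_nonneg
        · have := MeromorphicOn.AnalyticOnNhd.divisor_nonneg hf'
          exact_mod_cast this u
        · by_cases hcu : c = u
          · simp [hcu]
          · apply Real.log_nonneg
            rw [← div_eq_mul_inv, one_le_div (by simpa [sub_eq_zero] using hcu)]
            rw [habs, mem_closedBall, dist_eq_norm] at hu
            rwa [norm_sub_rev]
      · simp [hu]
    linarith
  have hlogint : CircleIntegrable (fun w => Real.log ‖f w‖) c R :=
    MeromorphicOn.circleIntegrable_log_norm (hf'.mono sphere_subset_closedBall).meromorphicOn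
  have hae : ∀ᵐ θ ∂(volume.restrict (uIoc (0:ℝ) (2 * Real.pi))), f (circleMap c R θ) ≠ 0 := by
    have h1 := hf'.preimage_zero_mem_codiscreteWithin h0 (by simp)
      ⟨nonempty_closedBall.mpr (abs_nonneg R), (convex_closedBall c |R|).isPreconnected⟩
    have h2 := codiscreteWithin_mono sphere_subset_closedBall h1
    apply ae_restrict_le_codiscreteWithin measurableSet_uIoc
    exact codiscreteWithin_mono (by tauto) (circleMap_preimage_codiscrete hR.ne' h2)
  set V := ‖f c‖ ^ p with hV
  have hVpos : 0 < V := Real.rpow_pos_of_pos (norm_pos_iff.mpr h0) p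
  set l := Real.log ‖f c‖ with hl
  have key : ∀ w, f w ≠ 0 → V * (1 + p * (Real.log ‖f w‖ - l)) ≤ ‖f w‖ ^ p := by
    intro w hw
    have hn := norm_pos_iff.mpr hw
    have : ‖f w‖ ^ p = V * Real.exp (p * (Real.log ‖f w‖ - l)) := by
      rw [hV, Real.rpow_def_of_pos hn, Real.rpow_def_of_pos (norm_pos_iff.mpr h0), ← Real.exp_add]
      congr 1; rw [hl]; ring
    rw [this]
    gcongr
    linarith [Real.add_one_le_exp (p * (Real.log ‖f w‖ - l))]
  have hI : CircleIntegrable (fun w => V * (1 + p * (Real.log ‖f w‖ - l))) c R := by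
    have : CircleIntegrable (fun w => (V * p) • Real.log ‖f w‖ + (V - V * p * l)) c R :=
      (hlogint.const_smul).add (circleIntegrable_const _ _ _)
    convert this using 2
    simp; ring
  have hA : Real.circleAverage (fun w => V * (1 + p * (Real.log ‖f w‖ - l))) c R
      = V * (1 + p * (Real.circleAverage (Real.log ‖f ·‖) c R - l)) := by
    have : (fun w => V * (1 + p * (Real.log ‖f w‖ - l)))
      = fun w => (V * p) • Real.log ‖f w‖ + (V - V * p * l) := by
        funext w; simp; ring
    rw [this, Real.circleAverage_fun_add (f₁ := fun w => (V * p) • Real.log ‖f w‖)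
      hlogint.const_smul (circleIntegrable_const _ _ _),
      Real.circleAverage_fun_smul, Real.circleAverage_const]
    simp; ring
  calc V ≤ V * (1 + p * (Real.circleAverage (Real.log ‖f ·‖) c R - l)) := by
        have : 0 ≤ p * (Real.circleAverage (Real.log ‖f ·‖) c R - l) :=
          mul_nonneg hp.le (by linarith)
        nlinarith
    _ = _ := hA.symm
    _ ≤ _ := by
      unfold Real.circleAverage
      apply (mul_le_mul_iff_of_pos_left (by simp [Real.pi_pos])).2
      apply intervalIntegral.integral_mono_ae_restrict (by positivity) hI hint
      rw [uIoc_of_le (by positivity)] at hae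
      rw [restrict_Ioc_eq_restrict_Icc] at hae
      filter_upwards [hae] with θ hθ using key _ hθ

lemma ofReal_int_le {X : Type*} [MeasurableSpace X] (μ : Measure X) (g : X → ℝ) :
    ENNReal.ofReal (∫ x, g x ∂μ) ≤ ∫⁻ x, ENNReal.ofReal (g x) ∂μ := by
  by_cases hg : Integrable g μ
  · rw [integral_eq_lintegral_pos_part_sub_lintegral_neg_part hg]
    refine (ENNReal.ofReal_le_ofReal (sub_le_self _ ENNReal.toReal_nonneg)).trans ?_
    exact ENNReal.ofReal_toReal_le
  · rw [integral_undef hg]; simp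

lemma circ_lint {f : ℂ → ℂ} {c : ℂ} {R p l : ℝ} (hR : 0 < R) (hp : 0 < p)
    (hf : AnalyticOnNhd ℂ f (closedBall c R)) :
    ENNReal.ofReal (‖f c‖ ^ p - l) * ENNReal.ofReal (2 * Real.pi) ≤
      ∫⁻ θ in Ioo (-Real.pi) Real.pi, ENNReal.ofReal (‖f (circleMap c R θ)‖ ^ p - l) := by
  obtain ⟨h1, h2⟩ := circ_sub hR hp hf
  have hper : Function.Periodic (fun θ => ‖f (circleMap c R θ)‖ ^ p - l) (2 * Real.pi) :=
    fun x ↦ by simp [periodic_circleMap c R x]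
  have h3 : (‖f c‖ ^ p - l) * (2 * Real.pi) ≤
      ∫ θ in (0:ℝ)..(2 * Real.pi), (‖f (circleMap c R θ)‖ ^ p - l) := by
    rw [intervalIntegral.integral_sub h1 (by simp)]
    rw [Real.circleAverage_def, smul_eq_mul, inv_mul_eq_div, le_div_iff₀ (by positivity)] at h2
    simp
    linarith
  have h4 := hper.intervalIntegral_add_eq 0 (-Real.pi)
  rw [zero_add] at h4
  rw [h4, show -Real.pi + 2 * Real.pi = Real.pi by ring] at h3
  rw [intervalIntegral.integral_of_le (by linarith [Real.pi_pos]), integral_Ioc_eq_integral_Ioo] at h3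
  rw [← ENNReal.ofReal_mul' (by positivity)]
  refine (ENNReal.ofReal_le_ofReal h3).trans ?_
  exact ofReal_int_le _ _

lemma area_lint {f : ℂ → ℂ} {c : ℂ} {r p l : ℝ} (hr : 0 < r) (hp : 0 < p)
    (hf : AnalyticOnNhd ℂ f (ball c r)) (F : ℂ → ENNReal) (hFm : Measurable F)
    (hF : ∀ w ∈ ball c r, F w = ENNReal.ofReal (‖f w‖ ^ p - l)) :
    ENNReal.ofReal (‖f c‖ ^ p - l) * ENNReal.ofReal (Real.pi * r ^ 2) ≤ ∫⁻ w, F w := by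
  rw [← lintegral_add_left_eq_self F c, ← Complex.lintegral_comp_polarCoord_symm]
  have hpi := Real.pi_pos
  have hm : Measurable (fun p : ℝ × ℝ => ENNReal.ofReal p.1 • F (c + Complex.polarCoord.symm p)) := by
    simp only [Complex.polarCoord_symm_apply, smul_eq_mul]
    refine Measurable.mul (by fun_prop) (hFm.comp ?_)
    fun_prop
  calc _ = ∫⁻ ρ in Ioo 0 r, ENNReal.ofReal ρ * (ENNReal.ofReal (‖f c‖ ^ p - l) * ENNReal.ofReal (2 * Real.pi)) := by
        rw [lintegral_mul_const _ (by fun_prop), ← ofReal_integral_eq_lintegral_ofReal]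
        · rw [← integral_Ioc_eq_integral_Ioo, ← intervalIntegral.integral_of_le hr.le, integral_id]
          rw [mul_left_comm, ← ENNReal.ofReal_mul (p := (r ^ 2 - 0 ^ 2) / 2) (by simp; positivity)]
          congr 2
          ring
        · exact (continuous_id.integrableOn_Icc).mono_set Ioo_subset_Icc_self
        · filter_upwards [ae_restrict_mem measurableSet_Ioo] with x hx using hx.1.le
    _ ≤ ∫⁻ ρ in Ioo 0 r, ∫⁻ θ in Ioo (-Real.pi) Real.pi,
          ENNReal.ofReal ρ • F (c + Complex.polarCoord.symm (ρ, θ)) := by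
        refine setLIntegral_mono' measurableSet_Ioo ?_
        intro ρ hρ
        simp only [smul_eq_mul]
        rw [lintegral_const_mul]
        swap
        · simp only [Complex.polarCoord_symm_apply]
          refine hFm.comp ?_
          fun_prop
        gcongr
        refine (circ_lint hρ.1 hp (hf.mono (closedBall_subset_ball hρ.2))).trans ?_
        refine lintegral_mono fun θ => ?_
        have e : c + Complex.polarCoord.symm (ρ, θ) = circleMap c ρ θ := by
          simp [Complex.polarCoord_symm_apply, circleMap, Complex.exp_mul_I]
        rw [e, hF]
        simp [circleMap, abs_of_pos hρ.1, hρ.2]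
    _ = ∫⁻ p in Ioo 0 r ×ˢ Ioo (-Real.pi) Real.pi, ENNReal.ofReal p.1 • F (c + Complex.polarCoord.symm p) := by
        rw [Measure.volume_eq_prod, ← Measure.prod_restrict, lintegral_prod _ hm.aemeasurable]
    _ ≤ _ := by
        apply lintegral_mono_set
        rw [polarCoord_target]
        exact prod_mono Ioo_subset_Ioi_self subset_rfl

lemma inner_lint {M : ℝ} (hM : 0 < M) (k : ℝ) (G : ℝ → ENNReal)
    (h1 : ∀ y, |y - k| < M → y ≠ k → G y ≤ ENNReal.ofReal (Real.log M - Real.log (y - k)))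
    (h2 : ∀ y, M ≤ |y - k| → G y = 0) : ∫⁻ y, G y ≤ ENNReal.ofReal (2 * M) := by
  rw [← lintegral_add_left_eq_self G k]
  calc ∫⁻ y, G (k + y) ≤ ∫⁻ y, (Ioo (-M) M).indicator (fun y => ENNReal.ofReal (Real.log M - Real.log y)) y := by
        apply lintegral_mono_ae
        have : ∀ᵐ y : ℝ, y ≠ 0 := by simp [ae_iff]
        filter_upwards [this] with y hy
        by_cases hyM : y ∈ Ioo (-M) M
        · rw [indicator_of_mem hyM]
          have := h1 (k + y) (by simpa [abs_lt] using hyM) (by simpa using hy)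
          simpa using this
        · rw [indicator_of_notMem hyM, h2]
          rw [← not_lt]
          simpa [abs_lt] using hyM
    _ = ENNReal.ofReal (∫ y in Ioo (-M) M, (Real.log M - Real.log y)) := by
        rw [lintegral_indicator measurableSet_Ioo, ofReal_integral_eq_lintegral_ofReal]
        · have : IntervalIntegrable (fun y => Real.log M - Real.log y) volume (-M) M :=
            (by simp : IntervalIntegrable (fun y => Real.log M) volume (-M) M).sub
              intervalIntegral.intervalIntegrable_log'
          rw [intervalIntegrable_iff_integrableOn_Ioo_of_le (by linarith)] at this
          exact this
        · have hne : ∀ᵐ y : ℝ ∂(volume.restrict (Ioo (-M) M)), y ≠ 0 :=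
            ae_restrict_of_ae (by simp [ae_iff])
          filter_upwards [ae_restrict_mem measurableSet_Ioo, hne] with y hy h
          simp only [Pi.zero_apply, sub_nonneg]
          rw [← Real.log_abs y]
          exact Real.log_le_log (by positivity) (abs_le.mpr ⟨hy.1.le, hy.2.le⟩)
    _ ≤ _ := by
        apply ENNReal.ofReal_le_ofReal
        rw [← integral_Ioc_eq_integral_Ioo, ← intervalIntegral.integral_of_le (by linarith),
          intervalIntegral.integral_sub (by simp) intervalIntegral.intervalIntegrable_log',
          integral_log]
        simp
        linarith

lemma cart_lint {δ M : ℝ} (hδ : 0 < δ) (hM : 0 < M) (k : ℝ → ℝ) (G : ℂ → ENNReal) (hG : Measurable G)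
    (h0 : ∀ x y : ℝ, δ ≤ |x| → G ⟨x, y⟩ = 0)
    (h1 : ∀ x y : ℝ, |x| < δ → |y - k x| < M → y ≠ k x →
      G ⟨x, y⟩ ≤ ENNReal.ofReal (Real.log M - Real.log (y - k x)))
    (h2 : ∀ x y : ℝ, |x| < δ → M ≤ |y - k x| → G ⟨x, y⟩ = 0) :
    ∫⁻ w, G w ≤ ENNReal.ofReal (4 * M * δ) := by
  rw [← (Complex.volume_preserving_equiv_real_prod.symm).lintegral_comp_emb
    Complex.measurableEquivRealProd.symm.measurableEmbedding, Measure.volume_eq_prod,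
    lintegral_prod _ (by fun_prop)]
  calc _ ≤ ∫⁻ x, (Ioo (-δ) δ).indicator (fun _ => ENNReal.ofReal (2 * M)) x := by
        refine lintegral_mono fun x => ?_
        by_cases hx : |x| < δ
        · rw [indicator_of_mem (by simpa [abs_lt] using hx)]
          exact inner_lint hM (k x) _ (fun y => h1 x y hx) (fun y => h2 x y hx)
        · have : ∀ y, G (Complex.measurableEquivRealProd.symm (x, y)) = 0 :=
            fun y => h0 x y (not_lt.mp hx)
          rw [lintegral_congr this]; simp
    _ ≤ _ := by
        rw [lintegral_indicator measurableSet_Ioo, setLIntegral_const, Real.volume_Ioo,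
          ← ENNReal.ofReal_mul (by positivity)]
        apply ENNReal.ofReal_le_ofReal
        linarith

/-- The analytic core: log-mean estimate on a disc crossed by a rotated graph. -/
lemma core {f : ℂ → ℂ} {z a₀ : ℂ} {δ M p l : ℝ} (hδ : 0 < δ) (hM : 0 < M) (hp : 0 < p)
    (U : ℂ ≃ₗᵢ[ℝ] ℂ) (k : ℝ → ℝ)
    (hza : dist z a₀ < δ / 2)
    (hf : AnalyticOnNhd ℂ f (ball z (δ / 2)))
    (hk : ∀ u : ℂ, ‖u‖ < δ → |u.im - k u.re| < M)
    (hbd : ∀ w ∈ ball z (δ / 2), (U (w - a₀)).im ≠ k (U (w - a₀)).re →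
      ‖f w‖ ^ p ≤ l + (Real.log M - Real.log ((U (w - a₀)).im - k (U (w - a₀)).re))) :
    ‖f z‖ ^ p ≤ l + 16 * M / (Real.pi * δ) := by
  classical
  set F : ℂ → ENNReal := (ball z (δ/2)).piecewise (fun w => ENNReal.ofReal (‖f w‖ ^ p - l)) (fun _ => 0)
    with hF
  have hFm : Measurable F := by
    apply ContinuousOn.measurable_piecewise _ continuousOn_const measurableSet_ball
    apply ENNReal.continuous_ofReal.comp_continuousOn
    exact (hf.continuousOn.norm.rpow_const (fun _ _ => Or.inr hp.le)).sub continuousOn_const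
  have hFin : ∀ w ∈ ball z (δ/2), F w = ENNReal.ofReal (‖f w‖ ^ p - l) := fun w hw => by
    rw [hF, piecewise_eq_of_mem _ _ _ hw]
  have hFout : ∀ w, w ∉ ball z (δ/2) → F w = 0 := fun w hw => by
    rw [hF, piecewise_eq_of_notMem _ _ _ hw]
  have h1 := area_lint (half_pos hδ) hp hf F hFm hFin
  have h2 : ∫⁻ w, F w = ∫⁻ u, F (a₀ + U.symm u) := by
    rw [U.symm.measurePreserving.lintegral_comp (f := fun w => F (a₀ + w)) (by fun_prop),
      lintegral_add_left_eq_self F a₀]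
  have hbig : ∀ u, δ ≤ ‖u‖ → F (a₀ + U.symm u) = 0 := by
    intro u hu
    apply hFout
    intro hw
    rw [mem_ball] at hw
    have : ‖u‖ = dist (a₀ + U.symm u) a₀ := by simp [dist_eq_norm]
    have h3 := dist_triangle (a₀ + U.symm u) z a₀
    linarith
  have h3 : ∫⁻ u, F (a₀ + U.symm u) ≤ ENNReal.ofReal (4 * M * δ) := by
    apply cart_lint hδ hM k (fun u => F (a₀ + U.symm u)) (hFm.comp (by fun_prop))
    · intro x y hx
      exact hbig _ (hx.trans (Complex.abs_re_le_norm ⟨x, y⟩))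
    · intro x y hx hy hne
      by_cases hw : a₀ + U.symm ⟨x, y⟩ ∈ ball z (δ / 2)
      · simp only [hFin _ hw]
        apply ENNReal.ofReal_le_ofReal
        have := hbd _ hw
        simp only [add_sub_cancel_left, LinearIsometryEquiv.apply_symm_apply] at this
        linarith [this hne]
      · simp [hFout _ hw]
    · intro x y hx hy
      apply hbig
      by_contra hlt
      have := hk ⟨x, y⟩ (not_le.mp hlt)
      exact absurd this (not_lt.mpr hy)
  rw [h2] at h1
  have h4 := h1.trans h3
  have hpi := Real.pi_pos
  rw [← ENNReal.ofReal_mul' (by positivity), ENNReal.ofReal_le_ofReal_iff (by positivity)] at h4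
  rw [← sub_le_iff_le_add', le_div_iff₀ (by positivity)]
  have : (‖f z‖ ^ p - l) * (Real.pi * δ) * δ ≤ 16 * M * δ := by nlinarith
  exact le_of_mul_le_mul_right this hδ

/-- Corollary 2.9(2): logarithmic estimate for analytic functions near a
Lipschitz curve in the plane. -/
theorem stmt_7 (Ω : Set ℂ) (hΩo : IsOpen Ω) (hΩc : IsConnected Ω)
    (hΩb : Bornology.IsBounded Ω)
    (B : Set ℂ) (hB : IsClosed B) (hBΩ : (B ∩ Ω).Nonempty)
    (Γ : Set ℂ) (hΓ : IsLipschitzCurveC Γ)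
    (A : Set ℂ) (hA : IsCompact A) (hAΓ : A ⊆ Γ) (hAΩ : A ⊆ Ω)
    (f : ℂ → ℂ) (hf : AnalyticOnNhd ℂ f (Ω \ B))
    (a b α : ℝ) (ha : 0 < a) (hb : 0 < b) (hα0 : 0 < α) (hα1 : α < 1)
    (hbound : ∀ z ∈ Ω \ (A ∪ B), Metric.infDist z (A ∪ B) < α →
      ‖f z‖ ≤ a * Real.log (1 / Metric.infDist z (A ∪ B)) ^ b) :
    ∃ ε τ : ℝ, τ < ε ∧ 0 < τ ∧
      ∀ z ∈ Ω \ B, Metric.infDist z B < τ →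
        ‖f z‖ ≤ a * Real.log (ε / Metric.infDist z B) ^ b := by
  obtain ⟨-, L, R, hL, hR, hΓ⟩ := hΓ
  have hBne : B.Nonempty := hBΩ.mono inter_subset_left
  obtain ⟨η, hη, hηΩ⟩ := hA.exists_thickening_subset_open hΩo hAΩ
  set τ := min (min (α / 4) (η / 4)) (min (min (R / 4) (3 * L * R / 4)) 1) with hτ
  have hτ0 : 0 < τ := by
    simp only [hτ, lt_min_iff]
    refine ⟨⟨?_, ?_⟩, ⟨?_, ?_⟩, ?_⟩ <;> positivity
  have hτα : τ ≤ α / 4 := (min_le_left _ _).trans (min_le_left _ _)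
  have hτη : τ ≤ η / 4 := (min_le_left _ _).trans (min_le_right _ _)
  have hτR : τ ≤ R / 4 := ((min_le_right _ _).trans (min_le_left _ _)).trans (min_le_left _ _)
  have hτLR : τ ≤ 3 * L * R / 4 :=
    ((min_le_right _ _).trans (min_le_left _ _)).trans (min_le_right _ _)
  have hτ1 : τ ≤ 1 := (min_le_right _ _).trans (min_le_right _ _)
  have hexp : 1 ≤ Real.exp (16 * (1 + L)) := Real.one_le_exp (by positivity)
  refine ⟨2 * Real.exp (16 * (1 + L)), τ, by linarith, hτ0, ?_⟩
  intro z hz hzτ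
  set δ := infDist z B with hδdef
  have hδ : 0 < δ := (hB.notMem_iff_infDist_pos hBne).mp hz.2
  have hp : 0 < b⁻¹ := inv_pos.mpr hb
  -- the bound for the root
  have hroot : ∀ w ∈ Ω \ (A ∪ B), ∀ d, 0 < d → d ≤ infDist w (A ∪ B) → infDist w (A ∪ B) < α →
      ‖f w / a‖ ^ b⁻¹ ≤ Real.log (1 / d) := by
    intro w hw d hd hdle hlt
    have h := hbound w hw hlt
    have hpos : 0 < infDist w (A ∪ B) := hd.trans_le hdle
    have hlog : 0 ≤ Real.log (1 / infDist w (A ∪ B)) := by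
      apply Real.log_nonneg
      rw [one_le_div hpos]; linarith
    have hn : ‖f w / a‖ = ‖f w‖ / a := by simp [abs_of_pos ha]
    calc ‖f w / a‖ ^ b⁻¹ ≤ (Real.log (1 / infDist w (A ∪ B)) ^ b) ^ b⁻¹ := by
          apply Real.rpow_le_rpow (norm_nonneg _) _ hp.le
          rw [hn, div_le_iff₀ ha]; linarith
      _ = Real.log (1 / infDist w (A ∪ B)) := Real.rpow_rpow_inv hlog hb.ne'
      _ ≤ _ := by
          apply Real.log_le_log (by positivity)
          exact one_div_le_one_div_of_le hd hdle
  have hsplit : ∀ w d, (∀ q ∈ A, d ≤ dist w q) → (∀ q ∈ B, d ≤ dist w q) →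
      d ≤ infDist w (A ∪ B) := by
    intro w d h1 h2
    rw [le_infDist (hBne.mono subset_union_right)]
    rintro q (hq | hq)
    exacts [h1 q hq, h2 q hq]
  have hlt : ∀ w, infDist w (A ∪ B) ≤ infDist w B := fun w =>
    infDist_le_infDist_of_subset subset_union_right hBne
  suffices hmain : ‖f z / a‖ ^ b⁻¹ ≤ Real.log (2 / δ) + 16 * (1 + L) by
    have e : Real.log (2 * Real.exp (16 * (1 + L)) / δ) = Real.log (2 / δ) + 16 * (1 + L) := by
      rw [mul_div_right_comm, Real.log_mul (by positivity) (by positivity), Real.log_exp]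
    rw [e]
    have hn : ‖f z / a‖ = ‖f z‖ / a := by simp [abs_of_pos ha]
    have h2 := Real.rpow_le_rpow (by positivity) hmain hb.le
    rw [Real.rpow_inv_rpow (norm_nonneg _) hb.ne', hn, div_le_iff₀ ha] at h2
    linarith
  have hzB : ∀ q ∈ B, δ ≤ dist z q := fun q hq => infDist_le_dist_of_mem hq
  by_cases hfar : ∀ q ∈ A, δ / 2 ≤ dist z q
  · have hzA : z ∉ A := fun h => by have := hfar z h; rw [dist_self] at this; linarith
    have := hroot z ⟨hz.1, by rintro (h | h); exacts [hzA h, hz.2 h]⟩ (δ / 2) (by positivity)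
      (hsplit z _ hfar (fun q hq => by linarith [hzB q hq])) ((hlt z).trans_lt (by linarith))
    rw [one_div_div] at this
    linarith
  push Not at hfar
  obtain ⟨a₀, ha₀, hza⟩ := hfar
  obtain ⟨φ, hφ, U, hU⟩ := hΓ a₀ (hAΓ ha₀)
  have hgraph : ∀ q ∈ A, ‖q - a₀‖ < 2 * δ → (U (q - a₀)).im = φ (U (q - a₀)).re := by
    intro q hq hlt
    have hnorm : ‖U (q - a₀)‖ = ‖q - a₀‖ := U.norm_map _
    have : U (q - a₀) ∈ {z : ℂ | |z.re| < R ∧ z.im = φ z.re} := by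
      rw [← hU]
      refine ⟨⟨?_, ?_⟩, ⟨q - a₀, ⟨q, hAΓ hq, rfl⟩, rfl⟩⟩
      · exact (Complex.abs_re_le_norm _).trans_lt (by linarith)
      · exact (Complex.abs_im_le_norm _).trans_lt (by linarith)
    exact this.2
  have hφ0 : φ 0 = 0 := by
    have := hgraph a₀ ha₀ (by simpa using hδ)
    simpa using this.symm
  have hball : ∀ w ∈ ball z (δ / 2), ‖w - a₀‖ < δ := by
    intro w hw
    rw [mem_ball] at hw
    have := dist_triangle w z a₀
    rw [← dist_eq_norm]; linarith
  have hballB : ∀ w ∈ ball z (δ / 2), ∀ q ∈ B, δ / 2 ≤ dist w q := by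
    intro w hw q hq
    rw [mem_ball, dist_comm] at hw
    have := dist_triangle z w q
    linarith [hzB q hq]
  have hballΩ : ∀ w ∈ ball z (δ / 2), w ∈ Ω := by
    intro w hw
    apply hηΩ
    rw [mem_thickening_iff]
    refine ⟨a₀, ha₀, ?_⟩
    rw [dist_eq_norm]; linarith [hball w hw]
  have hballnB : ∀ w ∈ ball z (δ / 2), w ∉ B := by
    intro w hw hwB
    have := hballB w hw w hwB
    rw [dist_self] at this; linarith
  have hM : 0 < (1 + L) * δ := by positivity
  have hf' : AnalyticOnNhd ℂ (fun w => f w / a) (ball z (δ / 2)) := fun w hw =>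
    (hf w ⟨hballΩ w hw, hballnB w hw⟩).div analyticAt_const (by exact_mod_cast ha.ne')
  have hcore := core (f := fun w => f w / a) (l := Real.log (2 / δ)) hδ hM hp U φ hza hf' ?_ ?_
  · refine hcore.trans ?_
    have : 16 * ((1 + L) * δ) / (Real.pi * δ) ≤ 16 * (1 + L) := by
      rw [div_le_iff₀ (by positivity)]
      have h1 : 1 ≤ Real.pi := by linarith [Real.pi_gt_three]
      have h2 : 0 ≤ 16 * ((1 + L) * δ) := by positivity
      nlinarith
    linarith
  · intro u hu
    have h1 := (Complex.abs_re_le_norm u).trans_lt hu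
    have h2 := (Complex.abs_im_le_norm u).trans_lt hu
    have h3 := hφ u.re (by rw [mem_ball, Real.dist_eq, sub_zero]; linarith) 0 (by simpa using hR)
    rw [hφ0, sub_zero, sub_zero] at h3
    have h4 : L * |u.re| ≤ L * δ := by gcongr
    have h5 := abs_sub u.im (φ u.re)
    linarith
  · intro w hw hne
    set u := U (w - a₀) with hu
    have hun : ‖u‖ < δ := by rw [hu, U.norm_map]; exact hball w hw
    set t := |u.im - φ u.re| with ht
    have ht0 : 0 < t := abs_pos.mpr (sub_ne_zero.mpr hne)
    have hure := (Complex.abs_re_le_norm u).trans_lt hun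
    have htM : t ≤ (1 + L) * δ := by
      have h2 := (Complex.abs_im_le_norm u).trans_lt hun
      have h3 := hφ u.re (by rw [mem_ball, Real.dist_eq, sub_zero]; linarith) 0 (by simpa using hR)
      rw [hφ0, sub_zero, sub_zero] at h3
      have h4 : L * |u.re| ≤ L * δ := by gcongr
      have h5 := abs_sub u.im (φ u.re)
      linarith
    have hdA : ∀ q ∈ A, min (δ / 2) (t / (1 + L)) ≤ dist w q := by
      intro q hq
      by_cases hwq : dist w q < δ
      · refine (min_le_right _ _).trans ?_
        rw [div_le_iff₀ (by positivity)]
        have hqa : ‖q - a₀‖ < 2 * δ := by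
          have := dist_triangle q w a₀
          rw [dist_comm q w, dist_eq_norm q, dist_eq_norm w a₀] at this
          linarith [hball w hw]
        have hg := hgraph q hq hqa
        set s := U (q - a₀) with hs
        have hsn : ‖s‖ < 2 * δ := by rw [hs, U.norm_map]; exact hqa
        have hsre := (Complex.abs_re_le_norm s).trans_lt hsn
        have hus : ‖u - s‖ = dist w q := by
          rw [hu, hs, ← map_sub, U.norm_map, dist_eq_norm]; congr 1; ring
        have h1 := Complex.abs_re_le_norm (u - s)
        have h2 := Complex.abs_im_le_norm (u - s)
        rw [hus] at h1 h2
        rw [Complex.sub_re] at h1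
        rw [Complex.sub_im] at h2
        have h3 := hφ s.re (by rw [mem_ball, Real.dist_eq, sub_zero]; linarith) u.re
          (by rw [mem_ball, Real.dist_eq, sub_zero]; linarith)
        rw [abs_sub_comm s.re] at h3
        have h4 : L * |u.re - s.re| ≤ L * dist w q := by gcongr
        have h5 : t ≤ |u.im - s.im| + |φ s.re - φ u.re| := by
          rw [ht, ← hg]; exact abs_sub_le _ _ _
        linarith
      · refine (min_le_left _ _).trans ?_
        linarith
    have hmpos : 0 < min (δ / 2) (t / (1 + L)) := lt_min (by positivity) (by positivity)
    have hwA : w ∉ A := fun h => by have := hdA w h; rw [dist_self] at this; linarith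
    have hwB : infDist w B < α := by
      have := infDist_le_infDist_add_dist (s := B) (x := w) (y := z)
      rw [mem_ball] at hw
      linarith
    have h := hroot w ⟨hballΩ w hw, by rintro (h | h); exacts [hwA h, hballnB w hw h]⟩
      _ hmpos (hsplit w _ hdA (fun q hq => (min_le_left _ _).trans (hballB w hw q hq)))
      ((hlt w).trans_lt hwB)
    refine h.trans ?_
    rw [← Real.log_abs (u.im - φ u.re), ← ht]
    have hlogt : Real.log t ≤ Real.log ((1 + L) * δ) := Real.log_le_log ht0 htM
    rcases min_choice (δ / 2) (t / (1 + L)) with hm | hm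
    · rw [hm, one_div_div]; linarith
    · rw [hm, one_div_div, Real.log_div (by positivity) ht0.ne',
        Real.log_mul (by positivity) hδ.ne', Real.log_div (by norm_num) hδ.ne']
      linarith [Real.log_nonneg (show (1:ℝ) ≤ 2 by norm_num)]
end
end

section
/- Let Ω be a bounded domain in the complex plane ℂ, let B ⊂ ℂ be closed with B ∩ Ω nonempty, and let A ⊂ Ω be a compact set contained in a finite union of Lipschitz curves. Let f be an analytic function on Ω ∖ B. If for some b > 0 and C > 0, |f(z)| ≤ C·dist(z, A ∪ B)^{−b} for all z ∈ Ω ∖ (A ∪ B), then there is a constant C₁ > 0 such that |f(z)| ≤ C₁·dist(z,B)^{−b} for all z ∈ Ω ∖ B. -/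
open MeasureTheory Metric Set Filter

noncomputable section

/-- Two-constants estimate, from Hadamard's three lines theorem. -/
lemma two_constants {f : ℂ → ℂ} {x y : ℂ} {ρ k m M : ℝ} (hρ : 0 < ρ) (hk : 0 < k)
    (hk2 : k < 1 / 2) (hm : 0 < m) (hmM : m ≤ M)
    (hf : ∀ w ∈ closedBall y ρ, DifferentiableAt ℂ f w)
    (h1 : ∀ w ∈ closedBall y (k * ρ), ‖f w‖ ≤ m)
    (h2 : ∀ w ∈ closedBall y ρ, ‖f w‖ ≤ M) (hx : dist x y ≤ ρ / 2) :
    ‖f x‖ ≤ m * (M / m) ^ (1 - Real.log 2 / Real.log (1 / k)) := by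
  have hlog2 : 0 < Real.log 2 := Real.log_pos (by norm_num)
  have h2k : 2 < 1 / k := by
    rw [lt_div_iff₀ hk]; linarith
  have hlk : Real.log 2 < Real.log (1 / k) := Real.log_lt_log (by norm_num) h2k
  have hlkpos : 0 < Real.log (1 / k) := hlog2.trans hlk
  have hθ : Real.log 2 / Real.log (1 / k) < 1 := (div_lt_one hlkpos).2 hlk
  have hq : 1 ≤ M / m := (one_le_div hm).2 hmM
  by_cases hin : dist x y ≤ k * ρ
  · calc ‖f x‖ ≤ m := h1 x hin
      _ = m * 1 := (mul_one m).symm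
      _ ≤ _ := by
        gcongr
        exact Real.one_le_rpow hq (by linarith)
  push Not at hin
  have hkρ : 0 < k * ρ := mul_pos hk hρ
  have hxy : 0 < dist x y := hkρ.trans hin
  have hxy0 : x - y ≠ 0 := by
    intro h
    rw [sub_eq_zero.1 h, dist_self] at hxy
    exact lt_irrefl _ hxy
  have hnorm : ‖x - y‖ = dist x y := (dist_eq_norm x y).symm
  set g : ℂ → ℂ := fun ζ => f (y + Complex.exp ζ) with hg
  set l := Real.log (k * ρ) with hl
  set u := Real.log ρ with hu
  have hul' : u - l = Real.log (1 / k) := by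
    rw [hl, hu, Real.log_mul hk.ne' hρ.ne', one_div, Real.log_inv]; ring
  have hul : l < u := by linarith
  have hmem : ∀ ζ : ℂ, ∀ s : ℝ, 0 < s → ζ.re ≤ Real.log s → y + Complex.exp ζ ∈ closedBall y s := by
    intro ζ s hs h
    rw [mem_closedBall, dist_eq_norm, add_sub_cancel_left, Complex.norm_exp]
    exact (Real.exp_le_exp.2 h).trans (Real.exp_log hs).le
  have hcl : closure (Complex.HadamardThreeLines.verticalStrip l u) ⊆ {ζ : ℂ | ζ.re ≤ u} := by
    apply closure_minimal
    · intro ζ hζ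
      exact hζ.2.le
    · exact isClosed_le Complex.continuous_re continuous_const
  have hd : DiffContOnCl ℂ g (Complex.HadamardThreeLines.verticalStrip l u) := by
    apply DifferentiableOn.diffContOnCl
    intro ζ hζ
    apply DifferentiableAt.differentiableWithinAt
    have := hf _ (hmem ζ ρ hρ (hcl hζ))
    exact DifferentiableAt.comp ζ this (by fun_prop)
  have hre : (Complex.log (x - y)).re = Real.log (dist x y) := by
    rw [Complex.log_re, hnorm]
  have hle : Real.log (dist x y) ≤ u - Real.log 2 := by
    rw [hu, ← Real.log_div hρ.ne' (by norm_num)]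
    exact Real.log_le_log hxy hx
  have hlle : l ≤ Real.log (dist x y) := Real.log_le_log hkρ hin.le
  have key := Complex.HadamardThreeLines.norm_le_interp_of_mem_verticalClosedStrip'
    (f := g) (z := Complex.log (x - y)) (a := m) (b := M) hul
    (by
      change (Complex.log (x - y)).re ∈ Icc l u
      rw [hre]
      exact ⟨hlle, by linarith⟩) hd
    ⟨M, by
      rintro _ ⟨ζ, hζ, rfl⟩
      exact h2 _ (hmem ζ ρ hρ hζ.2)⟩
    (by
      intro ζ hζ
      exact h1 _ (hmem ζ _ hkρ (le_of_eq hζ)))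
    (by
      intro ζ hζ
      exact h2 _ (hmem ζ _ hρ (le_of_eq hζ)))
  have hgx : g (Complex.log (x - y)) = f x := by
    simp [hg, Complex.exp_log hxy0]
  rw [hgx, hre, hul'] at key
  set t := (Real.log (dist x y) - l) / Real.log (1 / k) with ht
  have ht1 : t ≤ 1 - Real.log 2 / Real.log (1 / k) := by
    rw [ht, div_le_iff₀ hlkpos, sub_mul, div_mul_cancel₀ _ hlkpos.ne']
    linarith
  have hM : 0 < M := hm.trans_le hmM
  calc ‖f x‖ ≤ m ^ (1 - t) * M ^ t := key
    _ = m * (M / m) ^ t := by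
      rw [Real.rpow_sub hm, Real.rpow_one, Real.div_rpow hM.le hm.le]
      ring
    _ ≤ _ := by
      gcongr

/-- Uniform porosity at small scales. -/
def PorousUpTo (S : Set ℂ) (c ε₀ : ℝ) : Prop :=
  0 < c ∧ c ≤ 1 ∧ 0 < ε₀ ∧ ∀ x : ℂ, ∀ ε : ℝ, 0 < ε → ε ≤ ε₀ →
    ∃ y, closedBall y (c * ε) ⊆ closedBall x ε ∧ Disjoint (closedBall y (c * ε)) S

lemma PorousUpTo.union {S T : Set ℂ} {c₁ ε₁ c₂ ε₂ : ℝ} (hS : PorousUpTo S c₁ ε₁)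
    (hT : PorousUpTo T c₂ ε₂) : PorousUpTo (S ∪ T) (c₂ * c₁) (min ε₁ ε₂) := by
  obtain ⟨h1, h2, h3, h4⟩ := hS
  obtain ⟨k1, k2, k3, k4⟩ := hT
  refine ⟨mul_pos k1 h1, mul_le_one₀ k2 h1.le h2, lt_min h3 k3, fun x ε hε hle => ?_⟩
  obtain ⟨y, hy, hyS⟩ := h4 x ε hε (hle.trans (min_le_left _ _))
  obtain ⟨w, hw, hwT⟩ := k4 y (c₁ * ε) (mul_pos h1 hε)
    ((mul_le_of_le_one_left hε.le h2).trans (hle.trans (min_le_right _ _)))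
  rw [← mul_assoc] at hw hwT
  exact ⟨w, hw.trans hy, disjoint_union_right.2 ⟨hyS.mono_left hw, hwT⟩⟩

lemma PorousUpTo.iUnion (n : ℕ) (Γ : Fin n → Set ℂ)
    (h : ∀ i, ∃ c ε₀, PorousUpTo (Γ i) c ε₀) : ∃ c ε₀, PorousUpTo (⋃ i, Γ i) c ε₀ := by
  induction n with
  | zero =>
    refine ⟨1, 1, one_pos, le_rfl, one_pos, fun x ε _ _ => ⟨x, by simp, by simp⟩⟩
  | succ n ih =>
    obtain ⟨c₁, ε₁, h1⟩ := h 0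
    obtain ⟨c₂, ε₂, h2⟩ := ih (fun i => Γ i.succ) (fun i => h i.succ)
    have : (⋃ i, Γ i) = Γ 0 ∪ ⋃ i : Fin n, Γ i.succ := by
      ext z
      simp [Fin.exists_fin_succ]
    rw [this]
    exact ⟨_, _, h1.union h2⟩

lemma IsLipschitzCurveC.porous {S : Set ℂ} (hS : IsLipschitzCurveC S) :
    ∃ c ε₀, PorousUpTo S c ε₀ := by
  obtain ⟨-, L, R, hL, hR, h⟩ := hS
  have hL1 : 0 < 8 * (1 + L) := by positivity
  have hc : 0 < 1 / (8 * (1 + L)) := by positivity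
  have hc8 : 1 / (8 * (1 + L)) ≤ 1 / 8 := by
    apply one_div_le_one_div_of_le <;> linarith
  have hcL : 1 / (8 * (1 + L)) * (1 + L) = 1 / 8 := by
    field_simp
  generalize 1 / (8 * (1 + L)) = c at hc hc8 hcL
  refine ⟨c, min R (L * R), hc, by linarith, lt_min hR (mul_pos hL hR), fun x ε hε hle => ?_⟩
  have hεR : ε ≤ R := hle.trans (min_le_left _ _)
  have hεLR : ε ≤ L * R := hle.trans (min_le_right _ _)
  have hcε : c * ε ≤ ε / 8 := by nlinarith
  have hcε0 : 0 < c * ε := mul_pos hc hε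
  by_cases hd : Disjoint (closedBall x (c * ε)) S
  · exact ⟨x, closedBall_subset_closedBall (by linarith), hd⟩
  rw [Set.not_disjoint_iff] at hd
  obtain ⟨a, hax, haS⟩ := hd
  obtain ⟨φ, hφ, U, hU⟩ := h a haS
  have h0 : (0 : ℂ) ∈ {z : ℂ | |z.re| < R ∧ z.im = φ z.re} := by
    rw [← hU]
    refine ⟨⟨by simpa using hR, by simpa using by positivity⟩, 0, ⟨a, haS, by simp⟩, by simp⟩
  have hφ0 : φ 0 = 0 := by simpa using h0.2.symm
  set v : ℂ := ⟨0, ε / 4⟩ with hv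
  have hvn : ‖v‖ = ε / 4 := by
    have : v = ((ε / 4 : ℝ) : ℂ) * Complex.I := by
      apply Complex.ext <;> simp [hv]
    rw [this, norm_mul, Complex.norm_I, mul_one, Complex.norm_real, Real.norm_of_nonneg (by positivity)]
  refine ⟨a + U.symm v, ?_, ?_⟩
  · apply closedBall_subset_closedBall'
    have h1 : dist (a + U.symm v) a = ε / 4 := by
      rw [dist_eq_norm, add_sub_cancel_left, LinearIsometryEquiv.norm_map, hvn]
    have h2 := dist_triangle (a + U.symm v) a x
    have h3 : dist a x ≤ c * ε := hax
    linarith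
  · rw [Set.disjoint_left]
    intro w hw hwS
    set z := U (w - a) with hz
    have hzv : ‖z - v‖ ≤ c * ε := by
      have : z - v = U (w - (a + U.symm v)) := by
        rw [hz, ← sub_sub, map_sub U (w - a), LinearIsometryEquiv.apply_symm_apply]
      rw [this, LinearIsometryEquiv.norm_map, ← dist_eq_norm]
      exact hw
    have hre : |z.re| ≤ c * ε := by
      have := (Complex.abs_re_le_norm (z - v)).trans hzv
      simpa [hv] using this
    have him : |z.im - ε / 4| ≤ c * ε := by
      have := (Complex.abs_im_le_norm (z - v)).trans hzv
      simpa [hv] using this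
    have him' := abs_le.1 him
    have hreR : |z.re| < R := by linarith
    have hmem : z ∈ {z : ℂ | |z.re| < R ∧ z.im = φ z.re} := by
      rw [← hU]
      refine ⟨⟨hreR, ?_⟩, w - a, ⟨w, hwS, rfl⟩, rfl⟩
      rw [abs_lt]
      constructor <;> nlinarith
    have hlip := hφ z.re (by simpa using hreR) 0 (by simpa using hR)
    rw [hφ0, ← hmem.2, sub_zero, sub_zero] at hlip
    have h5 : z.im ≤ L * (c * ε) := (le_abs_self _).trans (hlip.trans (by gcongr))
    have h6 : c * ε + L * (c * ε) = ε / 8 := by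
      linear_combination ε * hcL
    linarith [him'.1]

/-- The maximal-function argument on a single disc. -/
lemma disc_bound {f : ℂ → ℂ} {E S : Set ℂ} {z : ℂ} {r c ε₀ b C : ℝ} (hr : 0 < r)
    (hE : E.Nonempty) (hS : PorousUpTo S c ε₀) (hrε : r ≤ ε₀) (hb : 0 < b) (hC : 0 < C)
    (hf : ∀ w ∈ closedBall z r, DifferentiableAt ℂ f w)
    (hES : ∀ w ∈ closedBall z r, ∀ e ∈ E, e ∈ S ∨ r ≤ dist w e)
    (hbound : ∀ w ∈ closedBall z r, 0 < infDist w E → ‖f w‖ ≤ C * infDist w E ^ (-b)) :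
    ‖f z‖ ≤ 2 ^ (b / (Real.log 2 / Real.log (1 / (c / 4)))) * (C * (c / 8) ^ (-b)) * r ^ (-b) := by
  obtain ⟨hc0, hc1, hε₀, hpor⟩ := hS
  have hθ0 : 0 < Real.log 2 / Real.log (1 / (c / 4)) := by
    apply div_pos (Real.log_pos (by norm_num)) (Real.log_pos _)
    rw [lt_div_iff₀ (by positivity)]; linarith
  have htc := fun (x y : ℂ) (ρ m M : ℝ) (h : 0 < ρ) => two_constants (f := f) (x := x) (y := y)
    (m := m) (M := M) h (k := c / 4) (by positivity) (by linarith)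
  generalize Real.log 2 / Real.log (1 / (c / 4)) = θ at hθ0 htc
  have hcont : ContinuousOn (fun w => ‖f w‖ * (r - dist w z) ^ b) (closedBall z r) := by
    apply ContinuousOn.mul
    · exact ContinuousOn.norm fun w hw => (hf w hw).continuousAt.continuousWithinAt
    · apply ContinuousOn.rpow_const
      · fun_prop
      · intro w hw
        exact Or.inr hb.le
  obtain ⟨x, hx, hmax⟩ := (isCompact_closedBall z r).exists_isMaxOn
    ⟨z, mem_closedBall_self hr.le⟩ hcont
  set N := ‖f x‖ * (r - dist x z) ^ b with hN
  have hmax' : ∀ w ∈ closedBall z r, ‖f w‖ * (r - dist w z) ^ b ≤ N := fun w hw => hmax hw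
  have hz := hmax' z (mem_closedBall_self hr.le)
  rw [dist_self, sub_zero] at hz
  have hrb : 0 < r ^ b := Real.rpow_pos_of_pos hr b
  suffices hsuff : N ≤ 2 ^ (b / θ) * (C * (c / 8) ^ (-b)) by
    rw [Real.rpow_neg hr.le, ← div_eq_mul_inv, le_div_iff₀ hrb]
    exact hz.trans hsuff
  rcases le_or_gt N 0 with hN0 | hN0
  · exact hN0.trans (by positivity)
  have hxr : dist x z ≤ r := hx
  have hxlt : dist x z < r := by
    refine lt_of_le_of_ne hxr fun h => ?_
    rw [hN, h, sub_self, Real.zero_rpow hb.ne', mul_zero] at hN0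
    exact lt_irrefl _ hN0
  obtain ⟨ε, hε⟩ : ∃ ε, ε = (r - dist x z) / 2 := ⟨_, rfl⟩
  have hε0 : 0 < ε := by linarith
  have hεr : ε ≤ r / 2 := by linarith [dist_nonneg (x := x) (y := z)]
  have hxb : closedBall x ε ⊆ closedBall z r := by
    apply closedBall_subset_closedBall'
    linarith
  obtain ⟨y, hy1, hy2⟩ := hpor x (ε / 4) (by positivity) (by linarith)
  have hyx : dist y x ≤ ε / 4 := hy1 (mem_closedBall_self (by positivity))
  have hyb : closedBall y (ε / 2) ⊆ closedBall x ε := by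
    apply closedBall_subset_closedBall'
    linarith
  have hεb : 0 < ε ^ b := Real.rpow_pos_of_pos hε0 b
  have hM : ∀ w ∈ closedBall y (ε / 2), ‖f w‖ ≤ N * ε ^ (-b) := by
    intro w hw
    have h1 : dist w x ≤ ε := hyb hw
    have h2 := hmax' w (hxb h1)
    have h3 : ε ≤ r - dist w z := by linarith [dist_triangle w x z]
    rw [Real.rpow_neg hε0.le, ← div_eq_mul_inv, le_div_iff₀ hεb]
    refine le_trans ?_ h2
    gcongr
  have hm : ∀ w ∈ closedBall y (c / 4 * (ε / 2)), ‖f w‖ ≤ C * (c / 8 * ε) ^ (-b) := by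
    intro w hw
    have hwz : w ∈ closedBall z r := by
      apply hxb; apply hyb
      refine closedBall_subset_closedBall ?_ hw
      nlinarith
    have hdist : c / 8 * ε ≤ infDist w E := by
      rw [le_infDist hE]
      intro e he
      rcases hES w hwz e he with h | h
      · by_contra! hlt
        refine Set.disjoint_left.1 hy2 ?_ h
        have : dist w y ≤ c / 4 * (ε / 2) := hw
        rw [mem_closedBall]
        have := dist_triangle e w y
        rw [dist_comm e w] at this
        linarith
      · nlinarith
    have hpos : 0 < c / 8 * ε := by positivity
    refine (hbound w hwz (hpos.trans_le hdist)).trans ?_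
    gcongr C * ?_
    exact Real.rpow_le_rpow_of_nonpos hpos hdist (by linarith)
  have hmeq : C * (c / 8 * ε) ^ (-b) = C * (c / 8) ^ (-b) * ε ^ (-b) := by
    rw [Real.mul_rpow (by positivity) hε0.le]; ring
  rw [hmeq] at hm
  set m₀ := C * (c / 8) ^ (-b) with hm₀
  have hm₀pos : 0 < m₀ := by positivity
  have hεnb : 0 < ε ^ (-b) := Real.rpow_pos_of_pos hε0 _
  have h2θ : (1 : ℝ) ≤ 2 ^ (b / θ) := Real.one_le_rpow (by norm_num) (by positivity)
  rcases le_or_gt N m₀ with hNm | hNm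
  · nlinarith
  have key := htc x y (ε / 2) (m₀ * ε ^ (-b)) (N * ε ^ (-b)) (by positivity) (by positivity)
    (by gcongr) (fun w hw => hf w (hxb (hyb hw))) hm hM (by rw [dist_comm]; linarith)
  rw [mul_div_mul_right _ _ hεnb.ne'] at key
  have hq : 0 < N / m₀ := by positivity
  have hfx : ‖f x‖ = N * (2 ^ b)⁻¹ * ε ^ (-b) := by
    have : r - dist x z = 2 * ε := by linarith
    rw [hN, this, Real.mul_rpow (by norm_num) hε0.le, Real.rpow_neg hε0.le]
    have : (2 : ℝ) ^ b ≠ 0 := by positivity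
    field_simp
  rw [hfx, Real.rpow_sub hq, Real.rpow_one] at key
  have h2b : (0 : ℝ) < 2 ^ b := by positivity
  have hqθ : 0 < (N / m₀) ^ θ := Real.rpow_pos_of_pos hq θ
  have key2 : (N / m₀) ^ θ ≤ 2 ^ b := by
    have h1 : m₀ * ε ^ (-b) * (N / m₀ / (N / m₀) ^ θ) = N * ((N / m₀) ^ θ)⁻¹ * ε ^ (-b) := by
      field_simp
    rw [h1] at key
    have h2 := le_of_mul_le_mul_right key hεnb
    have h3 := le_of_mul_le_mul_left h2 hN0
    exact (inv_le_inv₀ h2b hqθ).1 h3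
  have key3 : N / m₀ ≤ 2 ^ (b / θ) := by
    have h1 := Real.rpow_le_rpow hqθ.le key2 (inv_nonneg.2 hθ0.le)
    rwa [Real.rpow_rpow_inv hq.le hθ0.ne', ← Real.rpow_mul (by norm_num), ← div_eq_mul_inv] at h1
  exact (div_le_iff₀ hm₀pos).1 key3

/-- Corollary 2.11: power-type estimate for analytic functions near a
finite union of Lipschitz curves in the plane. -/
theorem stmt_9 (Ω : Set ℂ) (hΩo : IsOpen Ω) (hΩc : IsConnected Ω)
    (hΩb : Bornology.IsBounded Ω)
    (B : Set ℂ) (hB : IsClosed B) (hBΩ : (B ∩ Ω).Nonempty)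
    (n : ℕ) (Γ : Fin n → Set ℂ) (hΓ : ∀ i, IsLipschitzCurveC (Γ i))
    (A : Set ℂ) (hA : IsCompact A) (hAΓ : A ⊆ ⋃ i, Γ i) (hAΩ : A ⊆ Ω)
    (f : ℂ → ℂ) (hf : AnalyticOnNhd ℂ f (Ω \ B))
    (b C : ℝ) (hb : 0 < b) (hC : 0 < C)
    (hbound : ∀ z ∈ Ω \ (A ∪ B), ‖f z‖ ≤ C * Metric.infDist z (A ∪ B) ^ (-b)) :
    ∃ C₁ : ℝ, 0 < C₁ ∧ ∀ z ∈ Ω \ B, ‖f z‖ ≤ C₁ * Metric.infDist z B ^ (-b) := by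
  obtain ⟨c, ε₀, hpor⟩ := PorousUpTo.iUnion n Γ fun i => (hΓ i).porous
  obtain ⟨p, hpB, hpΩ⟩ := hBΩ
  obtain ⟨δ, hδ, hδΩ⟩ := hA.exists_cthickening_subset_open hΩo hAΩ
  obtain ⟨D, hD, hDb⟩ : ∃ D : ℝ, 0 < D ∧ ∀ z ∈ Ω, infDist z B ≤ D := by
    refine ⟨Metric.diam Ω + 1, by linarith [Metric.diam_nonneg (s := Ω)], fun z hz => ?_⟩
    have := infDist_le_dist_of_mem (x := z) hpB
    linarith [dist_le_diam_of_mem hΩb hz hpΩ]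
  have hBne : B.Nonempty := ⟨p, hpB⟩
  have hABne : (A ∪ B).Nonempty := ⟨p, Or.inr hpB⟩
  have hε₀ : 0 < ε₀ := hpor.2.2.1
  obtain ⟨κ, hκ0, hκ4, hκδ, hκε⟩ : ∃ κ : ℝ, 0 < κ ∧ κ ≤ 1 / 4 ∧ κ * D ≤ δ / 2 ∧ κ * D ≤ ε₀ := by
    refine ⟨min (1 / 4) (min (δ / 2 / D) (ε₀ / D)), by positivity, min_le_left _ _, ?_, ?_⟩
    · rw [← le_div_iff₀ hD]
      exact (min_le_right _ _).trans (min_le_left _ _)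
    · rw [← le_div_iff₀ hD]
      exact (min_le_right _ _).trans (min_le_right _ _)
  obtain ⟨K, hK⟩ : ∃ K : ℝ, K = 2 ^ (b / (Real.log 2 / Real.log (1 / (c / 4)))) *
    (C * (c / 8) ^ (-b)) := ⟨_, rfl⟩
  have hc0 : 0 < c := hpor.1
  have hK0 : 0 < K := by rw [hK]; positivity
  have hκb : 0 < κ ^ (-b) := Real.rpow_pos_of_pos hκ0 _
  refine ⟨(C + K) * κ ^ (-b), by positivity, fun z hz => ?_⟩
  have hd : 0 < infDist z B := (hB.notMem_iff_infDist_pos hBne).1 hz.2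
  obtain ⟨d, hdd⟩ : ∃ d, d = infDist z B := ⟨_, rfl⟩
  rw [← hdd] at hd ⊢
  have hdD : d ≤ D := hdd ▸ hDb z hz.1
  have hdB : ∀ e ∈ B, d ≤ dist z e := fun e he => hdd ▸ infDist_le_dist_of_mem he
  have hr : 0 < κ * d := by positivity
  have hrd : κ * d ≤ d / 4 := by nlinarith
  have hrD : κ * d ≤ κ * D := by gcongr
  have hdb : 0 < d ^ (-b) := Real.rpow_pos_of_pos hd _
  have hmul : (κ * d) ^ (-b) = κ ^ (-b) * d ^ (-b) := Real.mul_rpow hκ0.le hd.le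
  by_cases hdis : ∃ a ∈ A, dist z a ≤ κ * d
  · obtain ⟨a, haA, hza⟩ := hdis
    have hsub : closedBall z (κ * d) ⊆ Ω := by
      intro w hw
      apply hδΩ
      apply mem_cthickening_of_dist_le w a δ A haA
      have : dist w z ≤ κ * d := hw
      linarith [dist_triangle w z a]
    have hfar : ∀ w ∈ closedBall z (κ * d), ∀ e ∈ B, κ * d ≤ dist w e := by
      intro w hw e he
      have h1 : dist w z ≤ κ * d := hw
      have h2 := hdB e he
      have h3 := dist_triangle z w e
      rw [dist_comm z w] at h3
      linarith
    have hnB : ∀ w ∈ closedBall z (κ * d), w ∉ B := by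
      intro w hw hwB
      have := hfar w hw w hwB
      rw [dist_self] at this
      linarith
    have := disc_bound (f := f) (E := A ∪ B) (C := C) (b := b) hr hABne hpor (by linarith) hb hC
      (fun w hw => (hf w ⟨hsub hw, hnB w hw⟩).differentiableAt)
      (fun w hw e he => he.imp (fun h => hAΓ h) (fun h => hfar w hw e h))
      (fun w hw hpos => hbound w ⟨hsub hw, fun hwE => by
        rw [infDist_zero_of_mem hwE] at hpos
        exact lt_irrefl _ hpos⟩)
    rw [← hK, hmul] at this
    refine this.trans ?_
    rw [mul_assoc (C + K)]
    gcongr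
    linarith
  · push Not at hdis
    have hdist : κ * d ≤ infDist z (A ∪ B) := by
      rw [le_infDist hABne]
      rintro e (he | he)
      · exact (hdis e he).le
      · linarith [hdB e he]
    have hzA : z ∉ A ∪ B := by
      intro h
      rw [infDist_zero_of_mem h] at hdist
      linarith
    refine (hbound z ⟨hz.1, hzA⟩).trans ?_
    have := Real.rpow_le_rpow_of_nonpos hr hdist (by linarith : -b ≤ 0)
    rw [hmul] at this
    rw [mul_assoc (C + K)]
    exact mul_le_mul (by linarith) this (Real.rpow_nonneg infDist_nonneg _) (by linarith)
end
end

section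
/- Let k ≥ 2, let Ω ⊂ ℝ^k be a bounded open set, let F : Ω → [0,∞] be upper semicontinuous, fix a > 1, and let ε > 0 satisfy ∫_Ω (log_a⁺ F(x))^{k−1+ε} dx < ∞, where log_a⁺ t = max(log t / log a, 0). Let D > 0 and let λ be a positive integer such that a/(D^k·S₁) + a^{−λ} ≤ 1, where S₁ is the volume of the unit ball of ℝ^k. Set f₁(t) = m({x ∈ Ω : F(x) > a^t}), and for t > λ+1 define δ(t) = (λ+1)·((k−1)/ε)^{(k−1)/k}·(t−1−λ)^{−ε/k} and ψ(t) = [∫_{(t−λ)^{k−1+ε}}^{∞} f₁(s^{1/(k−1+ε)}) ds + (t−λ)^{k−1+ε}·f₁(t−λ)]^{1/k}. If u : Ω → ℝ is subharmonic with u ≤ F on Ω and u(x_t) ≥ a^t for some t > λ+1 and x_t ∈ Ω, then dist(x_t, ∂Ω) < D·δ(t)·ψ(t). -/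
open MeasureTheory Metric Set Filter

noncomputable section

/-- A real-valued function is subharmonic on `U` if it is upper semicontinuous on `U` and
satisfies the sub-mean-value inequality on every ball whose corresponding closed ball
lies in `U`. -/
def SubharmonicOn {k : ℕ} (u : EuclideanSpace ℝ (Fin k) → ℝ)
    (U : Set (EuclideanSpace ℝ (Fin k))) : Prop :=
  UpperSemicontinuousOn u U ∧
    ∀ x ∈ U, ∀ r : ℝ, 0 < r → Metric.closedBall x r ⊆ U →
      u x ≤ ⨍ y in Metric.ball x r, u y

/-- The volume S₁ of the unit ball of ℝ^k. -/
def unitBallVol (k : ℕ) : ℝ := (volume (Metric.ball (0 : EuclideanSpace ℝ (Fin k)) 1)).toReal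

/-- (log_a⁺ y)^e as an extended nonnegative real, for y ∈ [0,∞] (value ⊤ at y = ⊤). -/
def logaPlusPow (a e : ℝ) (y : EReal) : ENNReal :=
  if y = ⊤ then ⊤ else ENNReal.ofReal (max (Real.log y.toReal / Real.log a) 0 ^ e)

lemma usc_measurable_restrict {k : ℕ} {β : Type*} [LinearOrder β] [TopologicalSpace β]
    [OrderTopology β] [SecondCountableTopology β] [MeasurableSpace β] [BorelSpace β]
    {Ω : Set (EuclideanSpace ℝ (Fin k))}
    {u : EuclideanSpace ℝ (Fin k) → β} (hu : UpperSemicontinuousOn u Ω) :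
    Measurable (Ω.domRestrict u) :=
  (upperSemicontinuousOn_iff_restrict.2 hu).measurable

lemma usc_meas {k : ℕ} {β : Type*} [LinearOrder β] [TopologicalSpace β]
    [OrderTopology β] [SecondCountableTopology β] [MeasurableSpace β] [BorelSpace β]
    {Ω : Set (EuclideanSpace ℝ (Fin k))} (hΩo : IsOpen Ω)
    {u : EuclideanSpace ℝ (Fin k) → β} (hu : UpperSemicontinuousOn u Ω) (c : β) :
    MeasurableSet {x ∈ Ω | c < u x} := by
  have h := hΩo.measurableSet.subtype_image
    (usc_measurable_restrict hu (measurableSet_Ioi (a := c)))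
  convert h using 1
  ext x
  simp [and_comm]

lemma ball_sub_of_infDist {k : ℕ} {Ω : Set (EuclideanSpace ℝ (Fin k))}
    {x : EuclideanSpace ℝ (Fin k)} (hx : x ∈ Ω) (hΩo : IsOpen Ω) :
    Metric.ball x (Metric.infDist x (frontier Ω)) ⊆ Ω := by
  have hd : Disjoint (Metric.ball x (Metric.infDist x (frontier Ω))) (frontier Ω) :=
    Metric.disjoint_ball_infDist
  have hpre : IsPreconnected (Metric.ball x (Metric.infDist x (frontier Ω))) :=
    (convex_ball x _).isPreconnected
  rcases (Metric.infDist_nonneg (x := x) (s := frontier Ω)).eq_or_lt with h0 | h0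
  · rw [← h0]; simp
  refine hpre.subset_of_closure_inter_subset hΩo ⟨x, Metric.mem_ball_self h0, hx⟩ ?_
  rintro y ⟨hy1, hy2⟩
  by_contra hy
  refine Set.disjoint_left.1 hd hy2 ?_
  rw [hΩo.frontier_eq]
  exact ⟨hy1, hy⟩

lemma ball_step {k : ℕ} (hk : 2 ≤ k)
    {Ω : Set (EuclideanSpace ℝ (Fin k))} (hΩo : IsOpen Ω) (hΩb : Bornology.IsBounded Ω)
    {a : ℝ} (ha : 1 < a) {D : ℝ} (hD : 0 < D) {lam : ℕ}
    (hDlam : a / (D ^ k * unitBallVol k) + a ^ (-(lam : ℝ)) ≤ 1)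
    {u : EuclideanSpace ℝ (Fin k) → ℝ} (hu : SubharmonicOn u Ω)
    (g : ℝ → ℝ) (hg : ∀ s, g s = (volume {x ∈ Ω | a ^ s < u x}).toReal)
    {x : EuclideanSpace ℝ (Fin k)} (s R : ℝ) (hx : a ^ s ≤ u x) (hR : 0 < R)
    (hB : Metric.closedBall x R ⊆ Ω)
    (hRd : D ^ k * (g (s - lam) - g (s + 1)) < R ^ k) :
    ∃ y ∈ Metric.ball x R, a ^ (s + 1) ≤ u y := by
  by_contra! hcon
  have a0 : 0 < a := by linarith
  have hxΩ : x ∈ Ω := hB (Metric.mem_closedBall_self hR.le)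
  have havg := hu.2 x hxΩ R hR hB
  have hpos : 0 < a ^ s := Real.rpow_pos_of_pos a0 s
  have hfin : volume Ω ≠ ⊤ := hΩb.measure_lt_top.ne
  have hfm : IsFiniteMeasure (volume.restrict (Metric.ball x R)) :=
    isFiniteMeasure_restrict.2 measure_ball_lt_top.ne
  have hBΩ : Metric.ball x R ⊆ Ω := Metric.ball_subset_closedBall.trans hB
  have : Nonempty (Fin k) := ⟨⟨0, by omega⟩⟩
  have hS : 0 < unitBallVol k :=
    ENNReal.toReal_pos (Metric.measure_ball_pos _ _ one_pos).ne' measure_ball_lt_top.ne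
  have hvol : volume.real (Metric.ball x R) = R ^ k * unitBallVol k := by
    rw [Measure.real, Measure.addHaar_ball _ _ hR.le, ENNReal.toReal_mul,
      ENNReal.toReal_ofReal (by positivity)]
    simp [unitBallVol]
  have hint : IntegrableOn u (Metric.ball x R) := by
    by_contra hni
    rw [setAverage_eq, integral_undef hni] at havg
    simp at havg
    linarith
  set A : Set (EuclideanSpace ℝ (Fin k)) := {x ∈ Ω | a ^ (s - lam) < u x} with hA
  set A' : Set (EuclideanSpace ℝ (Fin k)) := {x ∈ Ω | a ^ (s + 1) < u x} with hA'
  have hAm : MeasurableSet A := usc_meas hΩo hu.1 _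
  have hAm' : MeasurableSet A' := usc_meas hΩo hu.1 _
  have hle : s - lam ≤ s + 1 := by have := Nat.cast_nonneg (α := ℝ) lam; linarith
  have hAA : A' ⊆ A := fun y hy =>
    ⟨hy.1, lt_of_le_of_lt (Real.rpow_le_rpow_of_exponent_le ha.le hle) hy.2⟩
  have hAf : volume A ≠ ⊤ := measure_ne_top_of_subset (fun y hy => hy.1) hfin
  have hAf' : volume A' ≠ ⊤ := measure_ne_top_of_subset (fun y hy => hy.1) hfin
  have hd : g (s - lam) - g (s + 1) = volume.real (A \ A') := by
    rw [measureReal_sdiff hAA hAm' hAf, hg, hg]; rfl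
  have hEf : volume (A \ A') ≠ ⊤ := measure_ne_top_of_subset sdiff_subset hAf
  have hint2 : IntegrableOn (fun y => a ^ (s - lam) +
      (A \ A').indicator (fun _ => a ^ (s + 1)) y) (Metric.ball x R) := by
    refine Integrable.add (integrable_const _) ?_
    exact (integrable_const _).indicator (hAm.diff hAm')
  have hbd : ∫ y in Metric.ball x R, u y ≤
      a ^ (s - lam) * (R ^ k * unitBallVol k) + a ^ (s + 1) * volume.real (A \ A') := by
    calc ∫ y in Metric.ball x R, u y ≤ ∫ y in Metric.ball x R, (a ^ (s - lam) +
      (A \ A').indicator (fun _ => a ^ (s + 1)) y) := by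
          refine setIntegral_mono_on hint hint2 measurableSet_ball ?_
          intro y hy
          have h1 := hcon y hy
          have p1 : 0 < a ^ (s - lam) := Real.rpow_pos_of_pos a0 _
          by_cases hyA : y ∈ A
          · have : y ∈ A \ A' := ⟨hyA, fun h => absurd h.2 (not_lt.2 h1.le)⟩
            rw [indicator_of_mem this]; linarith
          · have h2 : u y ≤ a ^ (s - lam) := by
              by_contra h; exact hyA ⟨hBΩ hy, not_le.1 h⟩
            rw [indicator_of_notMem (fun h => hyA h.1)]; linarith
      _ = a ^ (s - lam) * (R ^ k * unitBallVol k) +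
          a ^ (s + 1) * volume.real ((A \ A') ∩ Metric.ball x R) := by
          rw [integral_add (integrable_const _)
            ((integrable_const _).indicator (hAm.diff hAm')),
            integral_indicator (hAm.diff hAm')]
          simp [← hvol, Measure.restrict_restrict (hAm.diff hAm'), mul_comm]
      _ ≤ _ := by
          gcongr
          · exact inter_subset_left
  rw [setAverage_eq, hvol, smul_eq_mul] at havg
  rw [← hd] at hbd
  set d := g (s - lam) - g (s + 1)
  have hRS : 0 < R ^ k * unitBallVol k := by positivity
  have h1 : a ^ s * (R ^ k * unitBallVol k) ≤ ∫ y in Metric.ball x R, u y := by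
    have := hx.trans havg
    rw [inv_mul_eq_div, le_div_iff₀ hRS] at this
    exact this
  have e1 : a ^ (s - lam) = a ^ s * a ^ (-(lam : ℝ)) := by
    rw [← Real.rpow_add a0]; rfl
  have e2 : a ^ (s + 1) = a ^ s * a := by
    rw [Real.rpow_add a0, Real.rpow_one]
  have h2 := h1.trans hbd
  rw [e1, e2, mul_assoc, mul_assoc, ← mul_add, mul_le_mul_iff_right₀ hpos] at h2
  have hDk : 0 < D ^ k * unitBallVol k := by positivity
  have h3 : a * d < (a / (D ^ k * unitBallVol k)) * (R ^ k * unitBallVol k) := by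
    rw [div_mul_eq_mul_div, lt_div_iff₀ hDk]
    have := mul_lt_mul_of_pos_left hRd (mul_pos a0 hS)
    nlinarith
  have h4 := mul_le_mul_of_nonneg_right hDlam hRS.le
  nlinarith

lemma iter_contra {k : ℕ} (hk : 2 ≤ k)
    {Ω : Set (EuclideanSpace ℝ (Fin k))} (hΩo : IsOpen Ω) (hΩb : Bornology.IsBounded Ω)
    {a : ℝ} (ha : 1 < a) {D : ℝ} (hD : 0 < D) {lam : ℕ}
    (hDlam : a / (D ^ k * unitBallVol k) + a ^ (-(lam : ℝ)) ≤ 1)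
    {u : EuclideanSpace ℝ (Fin k) → ℝ} (hu : SubharmonicOn u Ω)
    (g : ℝ → ℝ) (hg : ∀ s, g s = (volume {x ∈ Ω | a ^ s < u x}).toReal)
    (hganti : Antitone g)
    {x : EuclideanSpace ℝ (Fin k)} (t S ρ : ℝ) (hx : a ^ t ≤ u x) (hSρ : S < ρ)
    (hB : Metric.closedBall x ρ ⊆ Ω)
    (hS : ∀ N : ℕ, D * ∑ n ∈ Finset.range N,
      (g (t + n - lam) - g (t + n + 1)) ^ (1 / (k : ℝ)) ≤ S) : False := by
  have hk0 : k ≠ 0 := by omega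
  set d : ℕ → ℝ := fun n => g (t + n - lam) - g (t + n + 1) with hd
  have hd0 : ∀ n, 0 ≤ d n := fun n => by
    have := hganti (show t + n - lam ≤ t + n + 1 by
      have := Nat.cast_nonneg (α := ℝ) lam; linarith)
    simp only [hd]; linarith
  set η := (ρ - S) / 2 with hη
  have hη0 : 0 < η := by rw [hη]; linarith
  set R : ℕ → ℝ := fun n => D * d n ^ (1 / (k : ℝ)) + η * (1 / 2) ^ n with hR
  have hgeo : ∀ N : ℕ, ∑ n ∈ Finset.range N, η * (1 / 2 : ℝ) ^ n ≤ 2 * η := by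
    intro N
    rw [← Finset.mul_sum]
    have := sum_geometric_two_le N
    nlinarith
  have hRsum : ∀ N, ∑ n ∈ Finset.range N, R n ≤ ρ := by
    intro N
    simp only [hR]
    rw [Finset.sum_add_distrib, ← Finset.mul_sum]
    have := hS N
    have := hgeo N
    simp only [hd] at *
    linarith
  have key : ∀ N : ℕ, ∃ y, dist y x ≤ ∑ n ∈ Finset.range N, R n ∧ a ^ (t + N) ≤ u y := by
    intro N
    induction N with
    | zero => exact ⟨x, by simp, by simpa using hx⟩
    | succ N ih =>
      obtain ⟨y, hy1, hy2⟩ := ih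
      have hp : 0 < η * (1 / 2 : ℝ) ^ N := by positivity
      have hdk : 0 ≤ D * d N ^ (1 / (k : ℝ)) := by have := hd0 N; positivity
      have hRN : 0 < R N := by simp only [hR]; linarith
      have hs := hRsum (N + 1)
      rw [Finset.sum_range_succ] at hs
      have hsub : Metric.closedBall y (R N) ⊆ Ω :=
        (Metric.closedBall_subset_closedBall' (by linarith)).trans hB
      have hlt : D ^ k * (g (t + N - lam) - g (t + N + 1)) < R N ^ k := by
        have e : D ^ k * d N = (D * d N ^ (1 / (k : ℝ))) ^ k := by
          rw [mul_pow, one_div, Real.rpow_inv_natCast_pow (hd0 N) hk0]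
        change D ^ k * d N < _
        rw [e]
        exact pow_lt_pow_left₀ (by simp only [hR]; linarith) hdk hk0
      obtain ⟨z, hz1, hz2⟩ := ball_step hk hΩo hΩb ha hD hDlam hu g hg (t + N) (R N) hy2 hRN
        hsub hlt
      refine ⟨z, ?_, by push_cast; rw [← add_assoc]; exact hz2⟩
      rw [Finset.sum_range_succ]
      have := dist_triangle z y x
      have := (Metric.mem_ball.1 hz1).le
      linarith
  obtain ⟨M, hM⟩ := (hu.1.mono hB).bddAbove_of_isCompact (isCompact_closedBall x ρ)
  have htend : Tendsto (fun n : ℕ => a ^ t * a ^ n) atTop atTop :=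
    (tendsto_pow_atTop_atTop_of_one_lt ha).const_mul_atTop (Real.rpow_pos_of_pos (by linarith) _)
  obtain ⟨n, hn⟩ := (htend.eventually_gt_atTop M).exists
  obtain ⟨y, hy1, hy2⟩ := key n
  have := hM ⟨y, Metric.mem_closedBall.2 (hy1.trans (hRsum n)), rfl⟩
  rw [Real.rpow_add (by linarith), Real.rpow_natCast] at hy2
  linarith

lemma sum_abel {f g : ℝ → ℝ} {p T : ℝ} (hp : 0 < p) (hT : 0 < T) (hf0 : ∀ s, 0 ≤ f s)
    (hg0 : ∀ s, 0 ≤ g s)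
    (hfa : Antitone f) (hgf : ∀ s, g s ≤ f s)
    (hint : IntegrableOn (fun s => f (s ^ (1 / p))) (Ioi (T ^ p))) (N : ℕ) :
    ∑ m ∈ Finset.range N, (T + m) ^ p * (g (T + m) - g (T + m + 1)) ≤
      (∫ s in Ioi (T ^ p), f (s ^ (1 / p))) + T ^ p * f T := by
  have hmono : ∀ x y : ℝ, T ≤ x → x ≤ y → x ^ p ≤ y ^ p := fun x y hx hxy =>
    Real.rpow_le_rpow (by linarith) hxy hp.le
  have hii : ∀ x y : ℝ, T ≤ x → x ≤ y →
      IntervalIntegrable (fun s => f (s ^ (1 / p))) volume (x ^ p) (y ^ p) := by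
    intro x y hx hxy
    rw [intervalIntegrable_iff_integrableOn_Ioc_of_le (hmono x y hx hxy)]
    refine hint.mono_set ?_
    intro s hs
    exact lt_of_le_of_lt (hmono T x le_rfl hx) hs.1
  have key : ∀ N : ℕ, ∑ m ∈ Finset.range N, (T + m) ^ p * (g (T + m) - g (T + m + 1)) ≤
      T ^ p * f T + (∫ s in (T ^ p)..((T + N) ^ p), f (s ^ (1 / p))) -
        (T + N) ^ p * g (T + N) := by
    intro N
    induction N with
    | zero =>
      simp
      have := hgf T
      have : 0 < T ^ p := by positivity
      gcongr
    | succ N ih =>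
      rw [Finset.sum_range_succ]
      have hN : (0 : ℝ) ≤ N := Nat.cast_nonneg N
      have e : T + ((N + 1 : ℕ) : ℝ) = T + N + 1 := by push_cast; ring
      rw [e, ← intervalIntegral.integral_add_adjacent_intervals
        (hii T (T + N) le_rfl (by linarith)) (hii (T + N) (T + N + 1) (by linarith) (by linarith))]
      have hw := hmono (T + N) (T + N + 1) (by linarith) (by linarith)
      have h1 : ((T + N + 1) ^ p - (T + N) ^ p) * g (T + N + 1) ≤
          ∫ s in ((T + N) ^ p)..((T + N + 1) ^ p), f (s ^ (1 / p)) := by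
        rw [← smul_eq_mul, ← intervalIntegral.integral_const]
        refine intervalIntegral.integral_mono_on hw (by simp)
          (hii (T + N) (T + N + 1) (by linarith) (by linarith)) ?_
        intro s hs
        refine (hgf _).trans (hfa ?_)
        have hs0 : 0 ≤ s := le_trans (by positivity) hs.1
        rw [one_div, Real.rpow_inv_le_iff_of_pos hs0 (by linarith) hp]
        exact hs.2
      linarith
  refine (key N).trans ?_
  have hN : (0 : ℝ) ≤ N := Nat.cast_nonneg N
  have h2 : (∫ s in (T ^ p)..((T + N) ^ p), f (s ^ (1 / p))) ≤
      ∫ s in Ioi (T ^ p), f (s ^ (1 / p)) := by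
    rw [intervalIntegral.integral_of_le (hmono T (T + N) le_rfl (by linarith))]
    exact setIntegral_mono_set hint (Eventually.of_forall fun s => hf0 _)
      (Ioc_subset_Ioi_self.eventuallyLE)
  have h3 : 0 ≤ (T + N) ^ p * g (T + N) := mul_nonneg (by positivity) (hg0 _)
  linarith

lemma sum_overlap {g : ℝ → ℝ} {p T Q : ℝ} (hp : 0 < p) (hT : 0 < T) (hga : Antitone g)
    (lam : ℕ)
    (hQ : ∀ N : ℕ, ∑ m ∈ Finset.range N, (T + m) ^ p * (g (T + m) - g (T + m + 1)) ≤ Q) (N : ℕ) :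
    ∑ n ∈ Finset.range N, (T + n) ^ p * (g (T + n) - g (T + n + lam + 1)) ≤ (lam + 1) * Q := by
  have he : ∀ m : ℕ, 0 ≤ (T + m) ^ p * (g (T + m) - g (T + m + 1)) := fun m => by
    have := hga (show T + m ≤ T + m + 1 by linarith)
    exact mul_nonneg (by positivity) (by linarith)
  have htel : ∀ n : ℕ, g (T + n) - g (T + n + lam + 1) =
      ∑ i ∈ Finset.range (lam + 1), (g (T + (n + i : ℕ)) - g (T + (n + i : ℕ) + 1)) := by
    intro n
    have := Finset.sum_range_sub' (fun i : ℕ => g (T + (n + i : ℕ))) (lam + 1)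
    simp only [Nat.add_zero] at this
    have e : T + ((n + (lam + 1) : ℕ) : ℝ) = T + n + lam + 1 := by push_cast; ring
    rw [e] at this
    rw [← this]
    refine Finset.sum_congr rfl fun i _ => ?_
    congr 2
    push_cast; ring
  calc ∑ n ∈ Finset.range N, (T + n) ^ p * (g (T + n) - g (T + n + lam + 1))
      ≤ ∑ n ∈ Finset.range N, ∑ i ∈ Finset.range (lam + 1), (T + (n + i : ℕ)) ^ p *
        (g (T + (n + i : ℕ)) - g (T + (n + i : ℕ) + 1)) := by
        refine Finset.sum_le_sum fun n _ => ?_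
        rw [htel, Finset.mul_sum]
        refine Finset.sum_le_sum fun i _ => ?_
        have := hga (show T + (n + i : ℕ) ≤ T + (n + i : ℕ) + 1 by linarith)
        refine mul_le_mul_of_nonneg_right ?_ (by linarith)
        refine Real.rpow_le_rpow (by positivity) ?_ hp.le
        push_cast
        have := Nat.cast_nonneg (α := ℝ) i
        linarith
    _ = ∑ i ∈ Finset.range (lam + 1), ∑ n ∈ Finset.range N, (T + (n + i : ℕ)) ^ p *
        (g (T + (n + i : ℕ)) - g (T + (n + i : ℕ) + 1)) := Finset.sum_comm
    _ ≤ ∑ i ∈ Finset.range (lam + 1), Q := by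
        refine Finset.sum_le_sum fun i _ => ?_
        refine le_trans ?_ (hQ (i + N))
        rw [Finset.sum_range_add]
        simp only [Nat.add_comm i]
        exact le_add_of_nonneg_left (Finset.sum_nonneg fun m _ => he m)
    _ = (lam + 1) * Q := by simp

lemma sum_pow_tail {β T : ℝ} (hβ : 0 < β) (hT : 1 < T) (N : ℕ) :
    ∑ n ∈ Finset.range N, (T + n) ^ (-1 - β) ≤ 1 / β * (T - 1) ^ (-β) := by
  have hstep : ∀ x : ℝ, 1 < x → β * x ^ (-1 - β) ≤ (x - 1) ^ (-β) - x ^ (-β) := by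
    intro x hx
    have x0 : 0 < x := by linarith
    have hy : 0 < 1 - 1 / x := by
      rw [sub_pos, div_lt_one x0]; exact hx
    have e1 : x - 1 = x * (1 - 1 / x) := by field_simp
    have h1 : 1 + β * (1 / x) ≤ (1 - 1 / x) ^ (-β) := by
      rw [Real.rpow_def_of_pos hy]
      have := Real.add_one_le_exp (Real.log (1 - 1 / x) * (-β))
      have := Real.log_le_sub_one_of_pos hy
      nlinarith
    rw [e1, Real.mul_rpow x0.le hy.le]
    have e2 : x ^ (-1 - β) = x ^ (-β) * (1 / x) := by
      rw [show -1 - β = -β + -1 by ring, Real.rpow_add x0, Real.rpow_neg_one, one_div]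
    rw [e2]
    have : 0 < x ^ (-β) := by positivity
    nlinarith
  have key : ∑ n ∈ Finset.range N, β * (T + n) ^ (-1 - β) ≤
      (T - 1) ^ (-β) - (T - 1 + N) ^ (-β) := by
    have := Finset.sum_range_sub' (fun i : ℕ => (T - 1 + i) ^ (-β)) N
    simp only [Nat.cast_zero, add_zero] at this
    rw [← this]
    refine Finset.sum_le_sum fun n _ => ?_
    have hn := Nat.cast_nonneg (α := ℝ) n
    refine (hstep (T + n) (by linarith)).trans (le_of_eq ?_)
    push_cast
    congr 2 <;> ring
  have hpos : 0 ≤ (T - 1 + N) ^ (-β) :=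
    Real.rpow_nonneg (by have := Nat.cast_nonneg (α := ℝ) N; linarith) _
  rw [← Finset.mul_sum] at key
  rw [one_div, ← div_eq_inv_mul, le_div_iff₀ hβ]
  linarith

lemma holder_sum {k : ℕ} (hk : 2 ≤ k) {ε T Q : ℝ} (hε : 0 < ε) (hT : 1 < T)
    {d : ℕ → ℝ} (hd : ∀ n, 0 ≤ d n) (N : ℕ)
    (hQ : ∑ n ∈ Finset.range N, (T + n) ^ ((k : ℝ) - 1 + ε) * d n ≤ Q) :
    ∑ n ∈ Finset.range N, d n ^ (1 / (k : ℝ)) ≤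
      Q ^ (1 / (k : ℝ)) *
        ((((k : ℝ) - 1) / ε) ^ (((k : ℝ) - 1) / k) * (T - 1) ^ (-(ε / k))) := by
  have hkr : (2 : ℝ) ≤ k := by exact_mod_cast hk
  have hk1 : (0 : ℝ) < k - 1 := by linarith
  have hk0 : (0 : ℝ) < k := by linarith
  have hconj : Real.HolderConjugate (k : ℝ) (k / (k - 1)) := by
    rw [Real.holderConjugate_iff]
    refine ⟨by linarith, ?_⟩
    field_simp
    ring
  set p : ℝ := (k : ℝ) - 1 + ε with hp
  have hTn : ∀ n : ℕ, 0 < T + n := fun n => by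
    have := Nat.cast_nonneg (α := ℝ) n; linarith
  have h := Real.inner_le_Lp_mul_Lq (Finset.range N)
    (fun n => ((T + n) ^ p * d n) ^ (1 / (k : ℝ))) (fun n => (T + n) ^ (-(p / k))) hconj
  have e1 : ∀ n : ℕ, ((T + n) ^ p * d n) ^ (1 / (k : ℝ)) * (T + n) ^ (-(p / k)) =
      d n ^ (1 / (k : ℝ)) := by
    intro n
    have := hTn n
    rw [Real.mul_rpow (by positivity) (hd n), ← Real.rpow_mul this.le, mul_right_comm,
      ← Real.rpow_add this]
    rw [show p * (1 / (k : ℝ)) + -(p / k) = 0 by ring, Real.rpow_zero, one_mul]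
  have e2 : ∀ n : ℕ, |((T + n) ^ p * d n) ^ (1 / (k : ℝ))| ^ (k : ℝ) = (T + n) ^ p * d n := by
    intro n
    have := hTn n
    have := hd n
    rw [abs_of_nonneg (by positivity), ← Real.rpow_mul (by positivity),
      one_div_mul_cancel hk0.ne', Real.rpow_one]
  have e3 : ∀ n : ℕ, |(T + n) ^ (-(p / k))| ^ ((k : ℝ) / (k - 1)) =
      (T + n) ^ (-1 - ε / (k - 1)) := by
    intro n
    have := hTn n
    rw [abs_of_nonneg (by positivity), ← Real.rpow_mul (by positivity)]
    congr 1
    rw [hp]; field_simp; ring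
  simp only [e1, e2, e3] at h
  refine h.trans ?_
  have hβ : 0 < ε / ((k : ℝ) - 1) := by positivity
  have h2 := sum_pow_tail hβ hT N
  have hs0 : 0 ≤ ∑ n ∈ Finset.range N, (T + n) ^ (-1 - ε / ((k : ℝ) - 1)) :=
    Finset.sum_nonneg fun n _ => (Real.rpow_pos_of_pos (hTn n) _).le
  have hs1 : 0 ≤ ∑ n ∈ Finset.range N, (T + n) ^ p * d n :=
    Finset.sum_nonneg fun n _ => mul_nonneg (Real.rpow_pos_of_pos (hTn n) _).le (hd n)
  have hT1 : 0 < T - 1 := by linarith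
  have e4 : (1 / (ε / ((k : ℝ) - 1)) * (T - 1) ^ (-(ε / ((k : ℝ) - 1)))) ^
      (1 / ((k : ℝ) / (k - 1))) =
      (((k : ℝ) - 1) / ε) ^ (((k : ℝ) - 1) / k) * (T - 1) ^ (-(ε / k)) := by
    rw [Real.mul_rpow (by positivity) (by positivity), ← Real.rpow_mul hT1.le, one_div_div,
      one_div_div]
    congr 2
    field_simp
  rw [← e4]
  have hq : 0 ≤ 1 / ((k : ℝ) / (k - 1)) := by positivity
  refine mul_le_mul (Real.rpow_le_rpow hs1 hQ (by positivity)) (Real.rpow_le_rpow hs0 h2 hq)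
    (Real.rpow_nonneg hs0 _) (Real.rpow_nonneg (hs1.trans hQ) _)

lemma f_integrable {k : ℕ}
    {Ω : Set (EuclideanSpace ℝ (Fin k))} (hΩo : IsOpen Ω)
    {F : EuclideanSpace ℝ (Fin k) → EReal} (hF : UpperSemicontinuousOn F Ω)
    {a : ℝ} (ha : 1 < a) {p : ℝ} (hp : 0 < p)
    (hInt : ∫⁻ x in Ω, logaPlusPow a p (F x) < ⊤)
    {f : ℝ → ℝ} (hf : ∀ t : ℝ, f t = (volume {x ∈ Ω | ((a ^ t : ℝ) : EReal) < F x}).toReal)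
    (hfa : Antitone f) :
    IntegrableOn (fun s => f (s ^ (1 / p))) (Ioi 0) := by
  have a0 : 0 < a := by linarith
  have hla : 0 < Real.log a := Real.log_pos ha
  have hFm : AEMeasurable F (volume.restrict Ω) :=
    aemeasurable_restrict_of_measurable_subtype hΩo.measurableSet (usc_measurable_restrict hF)
  set G : EuclideanSpace ℝ (Fin k) → ℝ :=
    fun x => max (Real.log (F x).toReal / Real.log a) 0 ^ p with hG
  have hGm : AEMeasurable G (volume.restrict Ω) := by
    have h1 : Measurable (fun y : EReal => max (Real.log y.toReal / Real.log a) 0 ^ p) := by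
      fun_prop
    exact h1.comp_aemeasurable hFm
  have hG0 : 0 ≤ᵐ[volume.restrict Ω] G := Eventually.of_forall fun x => by
    simp only [hG]; positivity
  have hlm : Measurable (fun y : EReal => logaPlusPow a p y) := by
    unfold logaPlusPow
    refine Measurable.ite (measurableSet_eq) measurable_const ?_
    fun_prop
  have hFtop : ∀ᵐ x ∂(volume.restrict Ω), F x ≠ ⊤ := by
    have := ae_lt_top' (hlm.comp_aemeasurable hFm) hInt.ne
    filter_upwards [this] with x hx hxt
    simp [logaPlusPow, hxt] at hx
  have hle : ∫⁻ x in Ω, ENNReal.ofReal (G x) < ⊤ := by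
    refine lt_of_le_of_lt (lintegral_mono_ae ?_) hInt
    filter_upwards [hFtop] with x hx
    simp [logaPlusPow, hx, hG]
  rw [lintegral_eq_lintegral_meas_lt _ hG0 hGm] at hle
  have hmeas : Measurable (fun s : ℝ => f (s ^ (1 / p))) :=
    hfa.measurable.comp (by fun_prop)
  refine ⟨hmeas.aestronglyMeasurable, ?_⟩
  rw [hasFiniteIntegral_iff_ofReal (Eventually.of_forall fun s => by
    simp only [hf]; exact ENNReal.toReal_nonneg)]
  refine lt_of_le_of_lt (setLIntegral_mono' measurableSet_Ioi ?_) hle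
  intro s hs
  have hs0 : 0 < s := hs
  rw [hf]
  refine ENNReal.ofReal_toReal_le.trans ?_
  have hms : MeasurableSet {x ∈ Ω | ((a ^ (s ^ (1 / p)) : ℝ) : EReal) < F x} :=
    usc_meas hΩo hF _
  have e : volume {x ∈ Ω | ((a ^ (s ^ (1 / p)) : ℝ) : EReal) < F x} =
      (volume.restrict Ω) {x ∈ Ω | ((a ^ (s ^ (1 / p)) : ℝ) : EReal) < F x} := by
    rw [Measure.restrict_apply hms, inter_eq_left.2 (fun x hx => hx.1)]
  rw [e]
  refine measure_mono_ae ?_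
  filter_upwards [hFtop] with x hx hx2
  have hx3 : ((a ^ (s ^ (1 / p)) : ℝ) : EReal) < F x := hx2.2
  change s < G x
  have hbot : F x ≠ ⊥ := by rintro h; rw [h] at hx3; simp at hx3
  lift F x to ℝ using ⟨hx, hbot⟩ with y hy
  simp only [hG, ← hy, EReal.toReal_coe]
  have hx4 : a ^ (s ^ (1 / p)) < y := by exact_mod_cast hx3
  have hapos : 0 < a ^ (s ^ (1 / p)) := by positivity
  have h5 : s ^ (1 / p) < Real.log y / Real.log a := by
    rw [lt_div_iff₀ hla, ← Real.log_rpow a0]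
    exact Real.log_lt_log hapos hx4
  calc s = (s ^ (1 / p)) ^ p := by
        rw [← Real.rpow_mul hs0.le, one_div_mul_cancel hp.ne', Real.rpow_one]
    _ < _ := Real.rpow_lt_rpow (by positivity) (lt_max_of_lt_left h5) hp

/-- Lemma 4.3: distance-to-boundary estimate deduced from Domar's
iteration, Theorem A setting. -/
theorem stmt_13 {k : ℕ} (hk : 2 ≤ k)
    (Ω : Set (EuclideanSpace ℝ (Fin k))) (hΩo : IsOpen Ω) (hΩb : Bornology.IsBounded Ω)
    (F : EuclideanSpace ℝ (Fin k) → EReal) (hF : UpperSemicontinuousOn F Ω)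
    (hF0 : ∀ x ∈ Ω, 0 ≤ F x)
    (a : ℝ) (ha : 1 < a)
    (ε : ℝ) (hε : 0 < ε)
    (hInt : ∫⁻ x in Ω, logaPlusPow a ((k : ℝ) - 1 + ε) (F x) < ⊤)
    (D : ℝ) (hD : 0 < D) (lam : ℕ) (hlam : 0 < lam)
    (hDlam : a / (D ^ k * unitBallVol k) + a ^ (-(lam : ℝ)) ≤ 1)
    (f₁ : ℝ → ℝ)
    (hf₁ : ∀ t : ℝ, f₁ t = (volume {x ∈ Ω | ((a ^ t : ℝ) : EReal) < F x}).toReal)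
    (δ ψ : ℝ → ℝ)
    (hδ : ∀ t : ℝ, δ t =
      (lam + 1) * (((k : ℝ) - 1) / ε) ^ (((k : ℝ) - 1) / k) * (t - 1 - lam) ^ (-(ε / k)))
    (hψ : ∀ t : ℝ, ψ t =
      ((∫ s in Set.Ioi ((t - lam) ^ ((k : ℝ) - 1 + ε)), f₁ (s ^ (1 / ((k : ℝ) - 1 + ε)))) +
        (t - lam) ^ ((k : ℝ) - 1 + ε) * f₁ (t - lam)) ^ (1 / (k : ℝ)))
    (u : EuclideanSpace ℝ (Fin k) → ℝ) (hu : SubharmonicOn u Ω)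
    (huF : ∀ x ∈ Ω, (u x : EReal) ≤ F x)
    (t : ℝ) (ht : (lam : ℝ) + 1 < t)
    (xt : EuclideanSpace ℝ (Fin k)) (hxt : xt ∈ Ω) (huxt : a ^ t ≤ u xt) :
    Metric.infDist xt (frontier Ω) < D * (δ t * ψ t) := by
  have a0 : 0 < a := by linarith
  have hkr : (2 : ℝ) ≤ k := by exact_mod_cast hk
  have hk0 : (0 : ℝ) < k := by linarith
  have hl : (1 : ℝ) ≤ lam := by exact_mod_cast hlam
  have hfin : volume Ω ≠ ⊤ := hΩb.measure_lt_top.ne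
  have hp : 0 < (k : ℝ) - 1 + ε := by linarith
  have hf0 : ∀ s, 0 ≤ f₁ s := fun s => by rw [hf₁]; exact ENNReal.toReal_nonneg
  have hfa : Antitone f₁ := by
    intro s s' hss
    rw [hf₁, hf₁]
    refine ENNReal.toReal_mono (measure_ne_top_of_subset (fun y hy => hy.1) hfin)
      (measure_mono fun y hy => ⟨hy.1, lt_of_le_of_lt ?_ hy.2⟩)
    exact_mod_cast Real.rpow_le_rpow_of_exponent_le ha.le hss
  set g : ℝ → ℝ := fun s => (volume {x ∈ Ω | a ^ s < u x}).toReal with hg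
  have hg0 : ∀ s, 0 ≤ g s := fun s => ENNReal.toReal_nonneg
  have hga : Antitone g := by
    intro s s' hss
    refine ENNReal.toReal_mono (measure_ne_top_of_subset (fun y hy => hy.1) hfin)
      (measure_mono fun y hy => ⟨hy.1, lt_of_le_of_lt ?_ hy.2⟩)
    exact Real.rpow_le_rpow_of_exponent_le ha.le hss
  have hgf : ∀ s, g s ≤ f₁ s := by
    intro s
    rw [hf₁]
    refine ENNReal.toReal_mono (measure_ne_top_of_subset (fun y hy => hy.1) hfin)
      (measure_mono fun y hy => ⟨hy.1, lt_of_lt_of_le ?_ (huF y hy.1)⟩)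
    exact_mod_cast hy.2
  have hT : 1 < t - lam := by linarith
  have hT0 : 0 < t - lam := by linarith
  have hint : IntegrableOn (fun s => f₁ (s ^ (1 / ((k : ℝ) - 1 + ε))))
      (Ioi ((t - lam) ^ ((k : ℝ) - 1 + ε))) :=
    (f_integrable hΩo hF ha hp hInt hf₁ hfa).mono_set
      (Ioi_subset_Ioi (Real.rpow_nonneg hT0.le _))
  have hψt := hψ t
  set Q : ℝ := (∫ s in Set.Ioi ((t - lam) ^ ((k : ℝ) - 1 + ε)),
    f₁ (s ^ (1 / ((k : ℝ) - 1 + ε)))) + (t - lam) ^ ((k : ℝ) - 1 + ε) * f₁ (t - lam) with hQ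
  have hQ0 : 0 ≤ Q := by
    have := hf0 (t - lam)
    refine add_nonneg (integral_nonneg fun s => hf0 _) (by positivity)
  have hsum := sum_overlap hp hT0 hga lam
    (fun N => sum_abel hp hT0 hf0 hg0 hfa hgf hint N)
  set C : ℝ := (((k : ℝ) - 1) / ε) ^ (((k : ℝ) - 1) / k) * (t - lam - 1) ^ (-(ε / k)) with hC
  have hC0 : 0 ≤ C := mul_nonneg (Real.rpow_nonneg (div_nonneg (by linarith) hε.le) _)
    (Real.rpow_nonneg (by linarith) _)
  have hCpos : 0 < C := mul_pos (Real.rpow_pos_of_pos (div_pos (by linarith) hε) _)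
    (Real.rpow_pos_of_pos (by linarith) _)
  have hδt : δ t = (lam + 1) * C := by
    rw [hδ, hC, mul_assoc, show t - 1 - (lam : ℝ) = t - lam - 1 by ring]
  set S : ℝ := D * ((((lam : ℝ) + 1) * Q) ^ (1 / (k : ℝ)) * C) with hS
  have hSN : ∀ N : ℕ, D * ∑ n ∈ Finset.range N,
      (g (t + n - lam) - g (t + n + 1)) ^ (1 / (k : ℝ)) ≤ S := by
    intro N
    refine mul_le_mul_of_nonneg_left ?_ hD.le
    refine holder_sum hk hε hT (d := fun n : ℕ => g (t + n - lam) - g (t + n + 1)) ?_ N ?_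
    · intro n
      have := hga (show t + n - lam ≤ t + n + 1 by linarith)
      linarith
    · refine le_trans (le_of_eq (Finset.sum_congr rfl fun n _ => ?_)) (hsum N)
      rw [show t - lam + (n : ℝ) = t + n - lam by ring,
        show t + n - (lam : ℝ) + lam + 1 = t + n + 1 by ring]
  have hlamk : ((lam : ℝ) + 1) ^ (1 / (k : ℝ)) < lam + 1 := by
    have h1 : 1 / (k : ℝ) < 1 := by rw [div_lt_one hk0]; linarith
    have := Real.rpow_lt_rpow_of_exponent_lt (show (1 : ℝ) < lam + 1 by linarith) h1
    rwa [Real.rpow_one] at this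
  have hSe : S = ((lam : ℝ) + 1) ^ (1 / (k : ℝ)) * (D * C * ψ t) := by
    rw [hS, Real.mul_rpow (by positivity) hQ0, hψt]; ring
  by_contra! hcon
  rw [hδt] at hcon
  have hψ0 : 0 ≤ ψ t := by rw [hψt]; positivity
  obtain ⟨ρ, hSρ, hρ⟩ : ∃ ρ, S < ρ ∧ Metric.closedBall xt ρ ⊆ Ω := by
    rcases hψ0.eq_or_lt with h0 | h0
    · have hS0 : S = 0 := by rw [hSe, ← h0]; simp
      obtain ⟨ρ, hρ, hsub⟩ := Metric.nhds_basis_closedBall.mem_iff.1 (hΩo.mem_nhds hxt)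
      exact ⟨ρ, by rw [hS0]; exact hρ, hsub⟩
    · have hlt : S < Metric.infDist xt (frontier Ω) := by
        refine lt_of_lt_of_le ?_ hcon
        rw [hSe, show D * ((lam + 1) * C * ψ t) = ((lam : ℝ) + 1) * (D * C * ψ t) by ring]
        exact mul_lt_mul_of_pos_right hlamk (by positivity)
      obtain ⟨ρ, h1, h2⟩ := exists_between hlt
      exact ⟨ρ, h1, (Metric.closedBall_subset_ball h2).trans (ball_sub_of_infDist hxt hΩo)⟩
  exact iter_contra hk hΩo hΩb ha hD hDlam hu g (fun s => rfl) hga t S ρ huxt hSρ hρ hSN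
end
end

section
/- Let k ≥ 2, let Ω ⊂ ℝ^k be a bounded open set, let F : Ω → [0,∞] be upper semicontinuous, fix a > 1, and let ε > 0 satisfy ∫_Ω (log_a⁺ F(x))^{k−1+ε} dx < ∞, where log_a⁺ t = max(log t / log a, 0). Assume moreover that m({x ∈ Ω : F(x) > s}) > 0 for every s > 0. Let D > 0 and let λ be a positive integer such that a/(D^k·S₁) + a^{−λ} ≤ 1, where S₁ is the volume of the unit ball of ℝ^k. Set f₁(t) = m({x ∈ Ω : F(x) > a^t}), and for t > λ+1 define φ(t) = δ(t)·ψ(t), where δ(t) = (λ+1)·((k−1)/ε)^{(k−1)/k}·(t−1−λ)^{−ε/k} and ψ(t) = [∫_{(t−λ)^{k−1+ε}}^{∞} f₁(s^{1/(k−1+ε)}) ds + (t−λ)^{k−1+ε}·f₁(t−λ)]^{1/k}. Let M(x) = sup{u(x) : u subharmonic on Ω, u ≤ F}. Then for every x ∈ Ω, M(x) ≤ a^{φ^−(dist(x,∂Ω)/D)}, where φ^−(s) = inf{t > λ+1 : φ(t) ≤ s}. -/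
open MeasureTheory Metric Set Filter

noncomputable section

lemma aux_meas {k : ℕ} {γ : Type*} [LinearOrder γ] [TopologicalSpace γ] [OrderTopology γ]
    [SecondCountableTopology γ] [MeasurableSpace γ] [BorelSpace γ]
    {Ω : Set (EuclideanSpace ℝ (Fin k))} (hΩo : IsOpen Ω)
    {f : EuclideanSpace ℝ (Fin k) → γ} (hf : UpperSemicontinuousOn f Ω) :
    Measurable (fun x : Ω => f x) := by
  have h : UpperSemicontinuous (Ω.domRestrict f) := upperSemicontinuousOn_iff_restrict.2 hf
  exact h.measurable

lemma aux_measSet {k : ℕ} 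
    {Ω : Set (EuclideanSpace ℝ (Fin k))} (hΩo : IsOpen Ω)
    {f : EuclideanSpace ℝ (Fin k) → ℝ} (hf : UpperSemicontinuousOn f Ω) {s : Set ℝ}
    (hs : MeasurableSet s) :
    MeasurableSet {z ∈ Ω | f z ∈ s} := by
  have h1 := aux_meas hΩo hf
  have h2 := hΩo.measurableSet.subtype_image (h1 hs)
  convert h2 using 1
  ext z; simp [and_comm]

lemma aux_ball {k : ℕ} (hk : 2 ≤ k) {Ω : Set (EuclideanSpace ℝ (Fin k))}
    (hΩb : Bornology.IsBounded Ω) {x : EuclideanSpace ℝ (Fin k)} (hx : x ∈ Ω)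
    {z : EuclideanSpace ℝ (Fin k)} (hz : dist x z < infDist x (frontier Ω)) : z ∈ Ω := by
  have : Nonempty (Fin k) := ⟨⟨0, by omega⟩⟩
  by_contra hzΩ
  have hne : Ω ≠ univ := fun h => hzΩ (h ▸ mem_univ z)
  obtain ⟨y, hy, hxy⟩ := exists_mem_frontier_infDist_compl_eq_dist hx hne
  have h1 : infDist x Ωᶜ ≤ dist x z := infDist_le_dist_of_mem hzΩ
  have h2 : infDist x (frontier Ω) ≤ dist x y := infDist_le_dist_of_mem hy
  linarith

lemma aux_pos {k : ℕ} (hk : 2 ≤ k) {Ω : Set (EuclideanSpace ℝ (Fin k))} (hΩo : IsOpen Ω)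
    (hΩb : Bornology.IsBounded Ω) {x : EuclideanSpace ℝ (Fin k)} (hx : x ∈ Ω) :
    0 < infDist x (frontier Ω) := by
  have : Nonempty (Fin k) := ⟨⟨0, by omega⟩⟩
  have hne : Ω ≠ univ := by
    rintro rfl
    exact NormedSpace.unbounded_univ ℝ (EuclideanSpace ℝ (Fin k)) hΩb
  have hfr : (frontier Ω).Nonempty := nonempty_frontier_iff.2 ⟨⟨x, hx⟩, hne⟩
  rw [← isClosed_frontier.notMem_iff_infDist_pos hfr]
  intro h
  have := hΩo.inter_frontier_eq
  exact (this ▸ (⟨hx, h⟩ : x ∈ Ω ∩ frontier Ω) : x ∈ (∅ : Set _))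

lemma aux_vol {k : ℕ} (hk : 2 ≤ k) (x : EuclideanSpace ℝ (Fin k)) {R : ℝ} (hR : 0 < R) :
    volume.real (ball x R) = R ^ k * unitBallVol k := by
  have : Nonempty (Fin k) := ⟨⟨0, by omega⟩⟩
  rw [measureReal_def, Measure.addHaar_ball_of_pos _ _ hR, ENNReal.toReal_mul, unitBallVol]
  simp [hR.le]

lemma aux_step {k : ℕ} (hk : 2 ≤ k) {Ω : Set (EuclideanSpace ℝ (Fin k))} (hΩo : IsOpen Ω)
    (hΩb : Bornology.IsBounded Ω) {a : ℝ} (ha : 1 < a) {D : ℝ} (hD : 0 < D) {lam : ℕ}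
    (hDlam : a / (D ^ k * unitBallVol k) + a ^ (-(lam : ℝ)) ≤ 1)
    {u : EuclideanSpace ℝ (Fin k) → ℝ} (hu : SubharmonicOn u Ω)
    {x : EuclideanSpace ℝ (Fin k)} {s R : ℝ} (hR : 0 < R) (hx : a ^ s < u x)
    (hb : closedBall x R ⊆ Ω)
    (hER : D ^ k * volume.real {z ∈ Ω | u z ∈ Ioc (a ^ (s - lam)) (a ^ (s + 1))} ≤ R ^ k) :
    ∃ y ∈ ball x R, a ^ (s + 1) < u y := by
  have ha0 : 0 < a := by linarith
  by_contra! hcon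
  set E := {z ∈ Ω | u z ∈ Ioc (a ^ (s - lam)) (a ^ (s + 1))} with hE
  have hEm : MeasurableSet E := aux_measSet hΩo hu.1 measurableSet_Ioc
  have hEfin : volume E ≠ ⊤ :=
    ((measure_mono (fun z hz => hz.1)).trans_lt hΩb.measure_lt_top).ne
  have hxΩ : x ∈ Ω := hb (mem_closedBall_self hR.le)
  have hmv := hu.2 x hxΩ R hR hb
  have hV := aux_vol hk x hR
  have hS : 0 < unitBallVol k := by
    unfold unitBallVol
    exact ENNReal.toReal_pos (measure_ball_pos _ _ one_pos).ne' measure_ball_lt_top.ne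
  rw [setAverage_eq, hV, smul_eq_mul] at hmv
  have hVpos : 0 < R ^ k * unitBallVol k := by positivity
  by_cases hi : IntegrableOn u (ball x R)
  · have hbfin : volume (ball x R) ≠ ⊤ := measure_ball_lt_top.ne
    have hint2 : IntegrableOn (E.indicator (fun _ => a ^ (s + 1))) (ball x R) :=
      (integrableOn_const hbfin).indicator hEm
    have hint1 : IntegrableOn (fun _ : EuclideanSpace ℝ (Fin k) => a ^ (s - lam)) (ball x R) :=
      integrableOn_const hbfin
    have hle : ∫ y in ball x R, u y ≤
        ∫ y in ball x R, (a ^ (s - lam) + E.indicator (fun _ => a ^ (s + 1)) y) := by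
      apply setIntegral_mono_on hi (hint1.add hint2) measurableSet_ball
      intro y hy
      have h1 := hcon y hy
      change u y ≤ a ^ (s - lam) + E.indicator (fun _ => a ^ (s + 1)) y
      by_cases h2 : y ∈ E
      · rw [indicator_of_mem h2]
        have : 0 < a ^ (s - lam) := Real.rpow_pos_of_pos ha0 _
        linarith
      · rw [indicator_of_notMem h2]
        have h3 : ¬ (a ^ (s - lam) < u y) := fun h => h2 ⟨hb (ball_subset_closedBall hy), h, h1⟩
        linarith
    rw [integral_add hint1 hint2, integral_indicator hEm,
      integral_const, integral_const, Measure.restrict_restrict hEm] at hle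
    simp only [measureReal_restrict_apply_univ, smul_eq_mul, hV] at hle
    have hm : volume.real (E ∩ ball x R) ≤ volume.real E :=
      measureReal_mono inter_subset_left hEfin
    have hA : a ^ (s + 1) = a ^ s * a := by rw [Real.rpow_add ha0, Real.rpow_one]
    have hB : a ^ (s - lam) = a ^ s * a ^ (-(lam : ℝ)) := by rw [← Real.rpow_add ha0]; ring_nf
    have has : 0 < a ^ s := Real.rpow_pos_of_pos ha0 _
    have h4 : volume.real E ≤ R ^ k / D ^ k := by
      rw [le_div_iff₀ (by positivity)]; linarith
    have h5 : ∫ y in ball x R, u y ≤ (R ^ k * unitBallVol k) * a ^ s := by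
      calc _ ≤ _ := hle
        _ ≤ R ^ k * unitBallVol k * (a ^ s * a ^ (-(lam : ℝ))) + (R ^ k / D ^ k) * (a ^ s * a) := by
            rw [hA, hB]
            gcongr
            exact hm.trans h4
        _ = (R ^ k * unitBallVol k * a ^ s) * (a / (D ^ k * unitBallVol k) + a ^ (-(lam : ℝ))) := by
            field_simp
            ring
        _ ≤ (R ^ k * unitBallVol k * a ^ s) * 1 := by gcongr
        _ = _ := by ring
    have h6 : (R ^ k * unitBallVol k)⁻¹ * ∫ y in ball x R, u y ≤ a ^ s := by
      rw [inv_mul_le_iff₀ hVpos]; exact h5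
    linarith
  · rw [integral_undef hi] at hmv
    have : 0 < a ^ s := Real.rpow_pos_of_pos ha0 _
    simp at hmv
    linarith

lemma aux_tele (α : ℝ) (hα : 0 < α) (T : ℝ) (hT : 1 < T) (N : ℕ) :
    ∑ i ∈ Finset.range N, (T + i) ^ (-1 - α) ≤ 1 / α * (T - 1) ^ (-α) := by
  have key : ∀ y : ℝ, 1 < y → α * y ^ (-1 - α) ≤ (y - 1) ^ (-α) - y ^ (-α) := by
    intro y hy
    have hy0 : 0 < y := by linarith
    have hx0 : 0 < y - 1 := by linarith
    have h1 : Real.log ((y - 1) / y) ≤ (y - 1) / y - 1 :=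
      Real.log_le_sub_one_of_pos (by positivity)
    have h2 : 1 + α / y ≤ ((y - 1) / y) ^ (-α) := by
      rw [Real.rpow_def_of_pos (by positivity)]
      have h3 := Real.add_one_le_exp (Real.log ((y - 1) / y) * (-α))
      have h4 : (y - 1) / y - 1 = - (1 / y) := by field_simp; ring
      rw [h4] at h1
      have : α / y = α * (1 / y) := by ring
      nlinarith
    rw [Real.div_rpow hx0.le hy0.le, le_div_iff₀ (Real.rpow_pos_of_pos hy0 _)] at h2
    have h5 : y ^ (-1 - α) = y ^ (-α) / y := by
      rw [show -1 - α = -α - 1 by ring, Real.rpow_sub_one hy0.ne']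
    rw [h5]
    have : (1 + α / y) * y ^ (-α) = y ^ (-α) + α * (y ^ (-α) / y) := by ring
    linarith
  have hind : ∀ N : ℕ, α * ∑ i ∈ Finset.range N, (T + i) ^ (-1 - α) ≤
      (T - 1) ^ (-α) - (T + N - 1) ^ (-α) := by
    intro N
    induction N with
    | zero => simp
    | succ n ih =>
      rw [Finset.sum_range_succ, mul_add]
      have hn : (0 : ℝ) ≤ n := n.cast_nonneg
      have := key (T + n) (by linarith)
      have e : T + ((n + 1 : ℕ) : ℝ) - 1 = T + n := by push_cast; ring
      rw [e]
      linarith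
  have h := hind N
  have hp : 0 < (T + N - 1) ^ (-α) := Real.rpow_pos_of_pos (by
    have hn : (0 : ℝ) ≤ N := N.cast_nonneg
    linarith) _
  rw [one_div, le_inv_mul_iff₀ hα]
  linarith

lemma aux_holder {k : ℕ} (hk : 2 ≤ k) {ε : ℝ} (hε : 0 < ε) (g : ℕ → ℝ) (hg : ∀ i, 0 ≤ g i)
    (T : ℝ) (hT : 1 < T) (N : ℕ) (I : ℝ)
    (hI : ∑ i ∈ Finset.range N, g i * (T + i) ^ ((k : ℝ) - 1 + ε) ≤ I) :
    ∑ i ∈ Finset.range N, (g i) ^ (1 / (k : ℝ)) ≤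
      (((k : ℝ) - 1) / ε) ^ (((k : ℝ) - 1) / k) * (T - 1) ^ (-(ε / k)) * I ^ (1 / (k : ℝ)) := by
  have hk2 : (2 : ℝ) ≤ k := by exact_mod_cast hk
  have hk1 : 0 < (k : ℝ) - 1 := by linarith
  have hk0 : 0 < (k : ℝ) := by linarith
  have hTi : ∀ i : ℕ, 0 < T + i := fun i => by
    have hn : (0 : ℝ) ≤ i := i.cast_nonneg
    linarith
  have hq : (k : ℝ).HolderConjugate (k / (k - 1)) := by
    have := Real.HolderConjugate.conjExponent (p := (k : ℝ)) (by linarith)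
    simpa [Real.conjExponent] using this
  set p := (k : ℝ) - 1 + ε with hp
  have h := Real.inner_le_Lp_mul_Lq_of_nonneg (Finset.range N) hq
    (f := fun i => (g i * (T + i) ^ p) ^ (1 / (k : ℝ))) (g := fun i => (T + i) ^ (-(p / k)))
    (fun i _ => Real.rpow_nonneg (mul_nonneg (hg i) (Real.rpow_nonneg (hTi i).le _)) _)
    (fun i _ => Real.rpow_nonneg (hTi i).le _)
  have e1 : ∀ i : ℕ, (g i * (T + i) ^ p) ^ (1 / (k : ℝ)) * (T + i) ^ (-(p / k))
      = (g i) ^ (1 / (k : ℝ)) := by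
    intro i
    rw [Real.mul_rpow (hg i) (Real.rpow_nonneg (hTi i).le _), ← Real.rpow_mul (hTi i).le, mul_assoc,
      ← Real.rpow_add (hTi i)]
    rw [show p * (1 / (k : ℝ)) + -(p / k) = 0 by ring]
    simp
  have e2 : ∀ i : ℕ, ((g i * (T + i) ^ p) ^ (1 / (k : ℝ))) ^ (k : ℝ) = g i * (T + i) ^ p := by
    intro i
    rw [← Real.rpow_mul (mul_nonneg (hg i) (Real.rpow_nonneg (hTi i).le _)),
      one_div_mul_cancel hk0.ne', Real.rpow_one]
  have e3 : ∀ i : ℕ, ((T + i) ^ (-(p / k))) ^ ((k : ℝ) / (k - 1)) =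
      (T + i) ^ (-1 - ε / (k - 1)) := by
    intro i
    rw [← Real.rpow_mul (hTi i).le]
    congr 1
    rw [hp]; field_simp; ring
  simp only [e1, e2, e3] at h
  have hα : 0 < ε / ((k : ℝ) - 1) := by positivity
  have ht := aux_tele (ε / ((k : ℝ) - 1)) hα T hT N
  have hT1 : 0 < T - 1 := by linarith
  have hs0 : 0 ≤ ∑ i ∈ Finset.range N, g i * (T + i) ^ p :=
    Finset.sum_nonneg fun i _ => mul_nonneg (hg i) (Real.rpow_nonneg (hTi i).le _)
  have hs1 : 0 ≤ ∑ i ∈ Finset.range N, (T + i) ^ (-1 - ε / ((k : ℝ) - 1)) :=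
    Finset.sum_nonneg fun i _ => (Real.rpow_nonneg (hTi i).le _)
  calc _ ≤ _ := h
    _ ≤ I ^ (1 / (k : ℝ)) * (1 / (ε / ((k : ℝ) - 1)) * (T - 1) ^ (-(ε / ((k : ℝ) - 1))))
          ^ (1 / ((k : ℝ) / (k - 1))) := by
        apply mul_le_mul
        · exact Real.rpow_le_rpow hs0 hI (by positivity)
        · exact Real.rpow_le_rpow hs1 ht (by positivity)
        · exact Real.rpow_nonneg hs1 _
        · exact Real.rpow_nonneg (hs0.trans hI) _
    _ = _ := by
        rw [one_div_div, one_div_div, Real.mul_rpow (by positivity) (Real.rpow_nonneg hT1.le _),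
          ← Real.rpow_mul hT1.le]
        rw [show -(ε / ((k : ℝ) - 1)) * (((k : ℝ) - 1) / k) = -(ε / k) by field_simp]
        ring

lemma aux_rpow_sum (f : ℕ → ℝ) (hf : ∀ i, 0 ≤ f i) {q : ℝ} (hq : 0 < q) (hq1 : q ≤ 1) (n : ℕ) :
    (∑ i ∈ Finset.range n, f i) ^ q ≤ ∑ i ∈ Finset.range n, (f i) ^ q := by
  induction n with
  | zero => simp [Real.zero_rpow hq.ne']
  | succ n ih =>
    rw [Finset.sum_range_succ, Finset.sum_range_succ]
    have := Real.rpow_add_le_add_rpow (Finset.sum_nonneg fun i (_ : i ∈ Finset.range n) => hf i)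
      (hf n) hq.le hq1
    linarith

/-- integral comparison for antitone f with Abel summation -/
lemma aux_abel (f G : ℕ → ℝ) (w : ℕ → ℝ) (h : ℝ → ℝ) (hG0 : ∀ i, 0 ≤ G i)
    (hGf : ∀ i, G i ≤ f i) (hw0 : 0 ≤ w 0) (hw : Monotone w)
    (hh0 : ∀ s, w 0 ≤ s → 0 ≤ h s)
    (hf : ∀ i, ∀ s ≤ w i, w 0 ≤ s → f i ≤ h s)
    (hint : IntegrableOn h (Ioi (w 0))) (N : ℕ) :
    ∑ i ∈ Finset.range N, (G i - G (i + 1)) * w i ≤ (∫ s in Ioi (w 0), h s) + w 0 * f 0 := by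
  have hII : ∀ i j : ℕ, IntervalIntegrable h volume (w i) (w j) := by
    intro i j
    have h0 : ∀ j : ℕ, IntervalIntegrable h volume (w 0) (w j) := fun j => by
      rw [intervalIntegrable_iff_integrableOn_Ioc_of_le (hw (Nat.zero_le j))]
      exact hint.mono_set Ioc_subset_Ioi_self
    exact (h0 i).symm.trans (h0 j)
  have hind : ∀ n : ℕ, ∑ i ∈ Finset.range (n + 1), (G i - G (i + 1)) * w i ≤
      (∫ s in (w 0)..(w n), h s) + w 0 * f 0 - G (n + 1) * w n := by
    intro n
    induction n with
    | zero =>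
      simp
      have := mul_le_mul_of_nonneg_right (hGf 0) hw0
      linarith
    | succ n ih =>
      rw [Finset.sum_range_succ, ← intervalIntegral.integral_add_adjacent_intervals
        (hII 0 n) (hII n (n + 1))]
      have hle : w n ≤ w (n + 1) := hw (Nat.le_succ n)
      have h1 : ∫ s in (w n)..(w (n + 1)), f (n + 1) ≤ ∫ s in (w n)..(w (n + 1)), h s := by
        apply intervalIntegral.integral_mono_on hle (by simp) (hII n (n + 1))
        intro s hs
        exact hf (n + 1) s hs.2 ((hw (Nat.zero_le n)).trans hs.1)
      rw [intervalIntegral.integral_const, smul_eq_mul] at h1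
      have h2 := mul_le_mul_of_nonneg_left (hGf (n + 1)) (sub_nonneg.2 hle)
      linarith
  have hI0 : 0 ≤ ∫ s in Ioi (w 0), h s :=
    setIntegral_nonneg measurableSet_Ioi fun s hs => hh0 s (le_of_lt hs)
  cases N with
  | zero =>
    simp
    have := mul_nonneg hw0 ((hG0 0).trans (hGf 0))
    linarith
  | succ n =>
    have h1 := hind n
    have h2 : ∫ s in (w 0)..(w n), h s ≤ ∫ s in Ioi (w 0), h s := by
      rw [intervalIntegral.integral_of_le (hw (Nat.zero_le n))]
      apply setIntegral_mono_set hint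
      · filter_upwards [ae_restrict_mem measurableSet_Ioi] with s hs using hh0 s (le_of_lt hs)
      · exact Ioc_subset_Ioi_self.eventuallyLE
    have h3 : 0 ≤ G (n + 1) * w n := mul_nonneg (hG0 _) (hw0.trans (hw (Nat.zero_le n)))
    linarith

lemma aux_integrable {k : ℕ} (hk : 2 ≤ k)
    {Ω : Set (EuclideanSpace ℝ (Fin k))} (hΩo : IsOpen Ω) (hΩb : Bornology.IsBounded Ω)
    {F : EuclideanSpace ℝ (Fin k) → EReal} (hF : UpperSemicontinuousOn F Ω)
    {a : ℝ} (ha : 1 < a) {p : ℝ} (hp : 0 < p)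
    (hInt : ∫⁻ x in Ω, logaPlusPow a p (F x) < ⊤)
    {f₁ : ℝ → ℝ} (hanti : Antitone f₁)
    (hf₁ : ∀ t : ℝ, f₁ t = (volume {x ∈ Ω | ((a ^ t : ℝ) : EReal) < F x}).toReal) :
    IntegrableOn (fun s => f₁ (s ^ (1 / p))) (Ioi 0) := by
  have ha0 : 0 < a := by linarith
  have hla : 0 < Real.log a := Real.log_pos ha
  have hmeas : Measurable (logaPlusPow a p) := by
    unfold logaPlusPow
    refine Measurable.ite (measurableSet_singleton _) measurable_const ?_
    refine ENNReal.measurable_ofReal.comp ?_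
    have : Measurable EReal.toReal := measurable_ereal_toReal
    have h2 : Measurable (fun y : ℝ => max (Real.log y / Real.log a) 0 ^ p) := by fun_prop
    exact h2.comp this
  have hFm : AEMeasurable (fun x => logaPlusPow a p (F x)) (volume.restrict Ω) :=
    aemeasurable_restrict_of_measurable_subtype hΩo.measurableSet
      (hmeas.comp (aux_meas hΩo hF))
  have hae : ∀ᵐ x ∂(volume.restrict Ω), logaPlusPow a p (F x) < ⊤ :=
    ae_lt_top' hFm hInt.ne
  have hlc := lintegral_eq_lintegral_meas_lt (volume.restrict Ω)
    (f := fun x => (logaPlusPow a p (F x)).toReal)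
    (Eventually.of_forall fun x => ENNReal.toReal_nonneg) hFm.ennreal_toReal
  have hfin : ∫⁻ t in Ioi (0 : ℝ), (volume.restrict Ω) {x | t < (logaPlusPow a p (F x)).toReal} < ⊤ := by
    rw [← hlc]
    refine (lintegral_mono fun x => ENNReal.ofReal_toReal_le).trans_lt hInt
  have hanti2 : AntitoneOn (fun s => f₁ (s ^ (1 / p))) (Ioi 0) := by
    intro s hs t ht hst
    exact hanti (Real.rpow_le_rpow (le_of_lt hs) hst (by positivity))
  refine ⟨(aemeasurable_restrict_of_antitoneOn measurableSet_Ioi hanti2).aestronglyMeasurable, ?_⟩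
  rw [hasFiniteIntegral_iff_ofReal]
  swap
  · exact Eventually.of_forall fun s => by simp only [hf₁]; exact ENNReal.toReal_nonneg
  refine lt_of_le_of_lt (setLIntegral_mono' measurableSet_Ioi fun s hs => ?_) hfin
  rw [hf₁]
  refine ENNReal.ofReal_toReal_le.trans ?_
  have hs0 : (0 : ℝ) < s := hs
  rw [← inter_setOf_eq_sep, inter_comm, ← Measure.restrict_apply' hΩo.measurableSet]
  refine measure_mono_ae ?_
  filter_upwards [hae] with x hx hxs
  change ((a ^ (s ^ (1 / p)) : ℝ) : EReal) < F x at hxs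
  change s < (logaPlusPow a p (F x)).toReal
  unfold logaPlusPow at hx ⊢
  split_ifs at hx ⊢ with htop
  · exact absurd hx (lt_irrefl _)
  · rw [ENNReal.toReal_ofReal (Real.rpow_nonneg (le_max_right _ _) _)]
    have hbot : F x ≠ ⊥ := fun h => by rw [h] at hxs; exact not_lt_bot hxs
    have hr : a ^ (s ^ (1 / p)) < (F x).toReal := by
      rw [← EReal.coe_toReal htop hbot] at hxs
      exact_mod_cast hxs
    have hpos : 0 < a ^ (s ^ (1 / p)) := Real.rpow_pos_of_pos ha0 _
    have h1 : s ^ (1 / p) < Real.log (F x).toReal / Real.log a := by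
      rw [lt_div_iff₀ hla, ← Real.log_rpow ha0]
      exact Real.log_lt_log hpos hr
    have h2 : 0 ≤ s ^ (1 / p) := Real.rpow_nonneg hs0.le _
    calc s = (s ^ (1 / p)) ^ p := by
            rw [← Real.rpow_mul hs0.le, one_div_mul_cancel hp.ne', Real.rpow_one]
      _ < _ := Real.rpow_lt_rpow h2 (h1.trans_le (le_max_left _ _)) hp

lemma aux_I_anti {f₁ : ℝ → ℝ} (hanti : Antitone f₁) (h0 : ∀ t, 0 ≤ f₁ t) {p : ℝ} (hp : 0 < p)
    (hint : IntegrableOn (fun s => f₁ (s ^ (1 / p))) (Ioi 0)) {T T' : ℝ} (hT : 0 < T)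
    (hTT : T ≤ T') :
    (∫ s in Ioi (T' ^ p), f₁ (s ^ (1 / p))) + T' ^ p * f₁ T' ≤
    (∫ s in Ioi (T ^ p), f₁ (s ^ (1 / p))) + T ^ p * f₁ T := by
  have hT' : 0 < T' := hT.trans_le hTT
  have hTp : 0 < T ^ p := Real.rpow_pos_of_pos hT _
  have hle : T ^ p ≤ T' ^ p := Real.rpow_le_rpow hT.le hTT hp.le
  have hIi : IntegrableOn (fun s => f₁ (s ^ (1 / p))) (Ioi (T ^ p)) :=
    hint.mono_set (Ioi_subset_Ioi hTp.le)
  have hII : IntervalIntegrable (fun s => f₁ (s ^ (1 / p))) volume (T ^ p) (T' ^ p) := by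
    rw [intervalIntegrable_iff_integrableOn_Ioc_of_le hle]
    exact hIi.mono_set Ioc_subset_Ioi_self
  have h1 : ∫ s in (T ^ p)..(T' ^ p), f₁ T' ≤ ∫ s in (T ^ p)..(T' ^ p), f₁ (s ^ (1 / p)) := by
    apply intervalIntegral.integral_mono_on hle (by simp) hII
    intro s hs
    apply hanti
    calc s ^ (1 / p) ≤ (T' ^ p) ^ (1 / p) :=
          Real.rpow_le_rpow (hTp.le.trans hs.1) hs.2 (by positivity)
      _ = T' := by rw [← Real.rpow_mul hT'.le, mul_one_div_cancel hp.ne', Real.rpow_one]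
  rw [intervalIntegral.integral_const, smul_eq_mul] at h1
  have h2 := intervalIntegral.integral_interval_add_Ioi (f := fun s => f₁ (s ^ (1 / p)))
    (μ := volume) hIi (hIi.mono_set (Ioi_subset_Ioi hle))
  have h3 : T ^ p * f₁ T' ≤ T ^ p * f₁ T := mul_le_mul_of_nonneg_left (hanti hTT) hTp.le
  linarith

/-- main sum bound -/
lemma aux_sum {k : ℕ} (hk : 2 ≤ k)
    {Ω : Set (EuclideanSpace ℝ (Fin k))} (hΩo : IsOpen Ω) (hΩb : Bornology.IsBounded Ω)
    {F : EuclideanSpace ℝ (Fin k) → EReal}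
    {a : ℝ} (ha : 1 < a) {ε : ℝ} (hε : 0 < ε)
    {f₁ : ℝ → ℝ} (hanti : Antitone f₁)
    (hf₁ : ∀ t : ℝ, f₁ t = (volume {x ∈ Ω | ((a ^ t : ℝ) : EReal) < F x}).toReal)
    (hint : IntegrableOn (fun s => f₁ (s ^ (1 / ((k : ℝ) - 1 + ε)))) (Ioi 0))
    {u : EuclideanSpace ℝ (Fin k) → ℝ} (hu : UpperSemicontinuousOn u Ω)
    (huF : ∀ z ∈ Ω, (u z : EReal) ≤ F z) (lam : ℕ) {T : ℝ} (hT : 1 < T) (N : ℕ) :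
    ∑ n ∈ Finset.range N,
      (volume.real {z ∈ Ω | u z ∈ Ioc (a ^ (T + n)) (a ^ (T + n + lam + 1))}) ^ (1 / (k : ℝ)) ≤
    ((lam + 1) * (((k : ℝ) - 1) / ε) ^ (((k : ℝ) - 1) / k) * (T - 1) ^ (-(ε / k))) *
      ((∫ s in Set.Ioi (T ^ ((k : ℝ) - 1 + ε)), f₁ (s ^ (1 / ((k : ℝ) - 1 + ε)))) +
        T ^ ((k : ℝ) - 1 + ε) * f₁ T) ^ (1 / (k : ℝ)) := by
  have ha0 : 0 < a := by linarith
  have hk2 : (2 : ℝ) ≤ k := by exact_mod_cast hk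
  set p := (k : ℝ) - 1 + ε with hp
  have hp0 : 0 < p := by linarith
  have hTi : ∀ i : ℕ, 0 < T + i := fun i => by
    have hn : (0 : ℝ) ≤ i := i.cast_nonneg
    linarith
  have hfin : ∀ P : EuclideanSpace ℝ (Fin k) → Prop, volume {z ∈ Ω | P z} ≠ ⊤ := fun P =>
    ((measure_mono (fun z hz => hz.1)).trans_lt hΩb.measure_lt_top).ne
  set G : ℕ → ℝ := fun i => volume.real {z ∈ Ω | u z ∈ Ioi (a ^ (T + i))} with hG
  have hm : ∀ i j : ℕ, i ≤ j → G i - G j =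
      volume.real {z ∈ Ω | u z ∈ Ioc (a ^ (T + i)) (a ^ (T + j))} := by
    intro i j hij
    have hsub : a ^ (T + i) ≤ a ^ (T + j) := by
      apply Real.rpow_le_rpow_of_exponent_le ha.le
      have : (i : ℝ) ≤ j := by exact_mod_cast hij
      linarith
    have h1 := measureReal_diff (μ := volume)
      (s₁ := {z ∈ Ω | u z ∈ Ioi (a ^ (T + i))}) (s₂ := {z ∈ Ω | u z ∈ Ioi (a ^ (T + j))})
      (fun z hz => ⟨hz.1, lt_of_le_of_lt hsub hz.2⟩)
      (aux_measSet hΩo hu measurableSet_Ioi) (hfin _)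
    rw [hG]
    simp only
    rw [← h1]
    congr 1
    ext z
    simp only [mem_diff, mem_setOf_eq, mem_Ioi, mem_Ioc, not_and, not_lt]
    tauto
  set g : ℕ → ℝ := fun i => G i - G (i + 1) with hg
  have hg0 : ∀ i, 0 ≤ g i := fun i => by
    simp only [hg]; rw [hm i (i + 1) (Nat.le_succ i)]; exact measureReal_nonneg
  have hI : ∀ N, ∑ i ∈ Finset.range N, g i * (T + i) ^ p ≤
      (∫ s in Set.Ioi (T ^ p), f₁ (s ^ (1 / p))) + T ^ p * f₁ T := by
    intro N
    have := aux_abel (fun i => f₁ (T + i)) G (fun i => (T + i) ^ p) (fun s => f₁ (s ^ (1 / p)))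
      (fun i => measureReal_nonneg) ?_ (Real.rpow_nonneg (hTi 0).le _) ?_ ?_ ?_ ?_ N
    · simpa using this
    · intro i
      simp only [hG, hf₁]
      refine ENNReal.toReal_mono (hfin _) (measure_mono fun z hz => ⟨hz.1, ?_⟩)
      refine lt_of_lt_of_le ?_ (huF z hz.1)
      exact_mod_cast hz.2
    · intro i j hij
      apply Real.rpow_le_rpow (hTi i).le _ hp0.le
      have : (i : ℝ) ≤ j := by exact_mod_cast hij
      linarith
    · intro s _
      simp only [hf₁]; exact ENNReal.toReal_nonneg
    · intro i s hs h0s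
      apply hanti
      have hs0 : 0 ≤ s := (Real.rpow_nonneg (hTi 0).le _).trans h0s
      calc s ^ (1 / p) ≤ ((T + i) ^ p) ^ (1 / p) :=
            Real.rpow_le_rpow hs0 hs (by positivity)
        _ = T + i := by rw [← Real.rpow_mul (hTi i).le, mul_one_div_cancel hp0.ne', Real.rpow_one]
    · exact hint.mono_set (Ioi_subset_Ioi (Real.rpow_nonneg (hTi 0).le _))
  have hh := aux_holder hk hε g hg0 T hT (N + lam) _ (hI (N + lam))
  have hstep : ∀ n : ℕ, (volume.real {z ∈ Ω | u z ∈ Ioc (a ^ (T + n)) (a ^ (T + n + lam + 1))})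
      ^ (1 / (k : ℝ)) ≤ ∑ j ∈ Finset.range (lam + 1), (g (n + j)) ^ (1 / (k : ℝ)) := by
    intro n
    have e : volume.real {z ∈ Ω | u z ∈ Ioc (a ^ (T + n)) (a ^ (T + n + lam + 1))} =
        ∑ j ∈ Finset.range (lam + 1), g (n + j) := by
      have h1 := hm n (n + (lam + 1)) (by omega)
      have h2 := Finset.sum_range_sub' (fun j => G (n + j)) (lam + 1)
      rw [show T + n + lam + 1 = T + ((n + (lam + 1) : ℕ) : ℝ) by push_cast; ring, ← h1]
      simp only [hg]
      rw [← add_zero n, add_zero n]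
      exact h2.symm
    rw [e]
    exact aux_rpow_sum _ (fun j => hg0 _) (by positivity)
      (by rw [div_le_one (by linarith)]; linarith) _
  calc _ ≤ ∑ n ∈ Finset.range N, ∑ j ∈ Finset.range (lam + 1), (g (n + j)) ^ (1 / (k : ℝ)) :=
        Finset.sum_le_sum fun n _ => hstep n
    _ = ∑ j ∈ Finset.range (lam + 1), ∑ n ∈ Finset.range N, (g (n + j)) ^ (1 / (k : ℝ)) :=
        Finset.sum_comm
    _ ≤ ∑ j ∈ Finset.range (lam + 1), ∑ i ∈ Finset.range (N + lam), (g i) ^ (1 / (k : ℝ)) := by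
        apply Finset.sum_le_sum
        intro j hj
        have hj' := Finset.mem_range.1 hj
        have : ∑ n ∈ Finset.range N, (g (n + j)) ^ (1 / (k : ℝ)) =
            ∑ i ∈ Finset.Ico j (N + j), (g i) ^ (1 / (k : ℝ)) := by
          rw [Finset.sum_Ico_eq_sum_range]
          simp [add_comm]
        rw [this]
        apply Finset.sum_le_sum_of_subset_of_nonneg
        · intro i hi
          simp only [Finset.mem_Ico, Finset.mem_range] at hi ⊢
          omega
        · intro i _ _
          exact Real.rpow_nonneg (hg0 i) _
    _ = (lam + 1) * ∑ i ∈ Finset.range (N + lam), (g i) ^ (1 / (k : ℝ)) := by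
        rw [Finset.sum_const, Finset.card_range, nsmul_eq_mul]; push_cast; ring
    _ ≤ (lam + 1) * _ := mul_le_mul_of_nonneg_left hh (by positivity)
    _ = _ := by ring

/-- chain argument -/
lemma aux_chain {k : ℕ} (hk : 2 ≤ k) {Ω : Set (EuclideanSpace ℝ (Fin k))} (hΩo : IsOpen Ω)
    (hΩb : Bornology.IsBounded Ω) {a : ℝ} (ha : 1 < a) {D : ℝ} (hD : 0 < D) {lam : ℕ}
    (hDlam : a / (D ^ k * unitBallVol k) + a ^ (-(lam : ℝ)) ≤ 1)
    {u : EuclideanSpace ℝ (Fin k) → ℝ} (hu : SubharmonicOn u Ω)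
    {x : EuclideanSpace ℝ (Fin k)} (hx : x ∈ Ω) {T B : ℝ}
    (hB : ∀ N, ∑ n ∈ Finset.range N,
      (volume.real {z ∈ Ω | u z ∈ Ioc (a ^ (T + n)) (a ^ (T + n + lam + 1))}) ^ (1 / (k : ℝ)) ≤ B)
    (hBd : D * B < infDist x (frontier Ω)) : u x ≤ a ^ (T + lam) := by
  have ha0 : 0 < a := by linarith
  have hk0 : (0 : ℝ) < k := by exact_mod_cast (by omega : 0 < k)
  by_contra! hcon
  set d := infDist x (frontier Ω) with hd
  set η := (d - D * B) / 2 with hη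
  have hη0 : 0 < η := by linarith
  set E : ℕ → ℝ := fun n =>
    (volume.real {z ∈ Ω | u z ∈ Ioc (a ^ (T + n)) (a ^ (T + n + lam + 1))}) ^ (1 / (k : ℝ)) with hE
  have hE0 : ∀ n, 0 ≤ E n := fun n => Real.rpow_nonneg measureReal_nonneg _
  set R : ℕ → ℝ := fun n => D * E n + η * (1 / 2 : ℝ) ^ (n + 1) with hR
  have hR0 : ∀ n, 0 < R n := fun n => by
    have := hE0 n
    simp only [hR]; positivity
  have hgeo : ∀ N : ℕ, ∑ n ∈ Finset.range N, (1 / 2 : ℝ) ^ (n + 1) ≤ 1 := by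
    intro N
    have : ∀ N : ℕ, ∑ n ∈ Finset.range N, (1 / 2 : ℝ) ^ (n + 1) = 1 - (1 / 2 : ℝ) ^ N := by
      intro N
      induction N with
      | zero => simp
      | succ n ih => rw [Finset.sum_range_succ, ih]; ring
    rw [this]
    have : (0 : ℝ) < (1 / 2 : ℝ) ^ N := by positivity
    linarith
  have hRsum : ∀ N, ∑ n ∈ Finset.range N, R n ≤ D * B + η := by
    intro N
    simp only [hR]
    rw [Finset.sum_add_distrib, ← Finset.mul_sum, ← Finset.mul_sum]
    have h1 := mul_le_mul_of_nonneg_left (hB N) hD.le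
    have h2 := mul_le_mul_of_nonneg_left (hgeo N) hη0.le
    linarith
  have hlt : D * B + η < d := by linarith
  have hchain : ∀ N : ℕ, ∃ y, dist x y ≤ ∑ n ∈ Finset.range N, R n ∧ a ^ (T + lam + N) < u y := by
    intro N
    induction N with
    | zero => exact ⟨x, by simp, by simpa using hcon⟩
    | succ n ih =>
      obtain ⟨y, hy, huy⟩ := ih
      have hsub : closedBall y (R n) ⊆ Ω := by
        intro z hz
        apply aux_ball hk hΩb hx
        have h1 := dist_triangle x y z
        have h2 : dist y z ≤ R n := by rw [dist_comm]; exact hz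
        have h3 := hRsum (n + 1)
        rw [Finset.sum_range_succ] at h3
        linarith
      obtain ⟨z, hz, huz⟩ := aux_step hk hΩo hΩb ha hD hDlam hu (hR0 n) huy hsub (by
        have e1 : T + lam + n - lam = T + n := by ring
        have e2 : T + lam + n + 1 = T + n + lam + 1 := by ring
        rw [e1, e2]
        have e3 : volume.real {z ∈ Ω | u z ∈ Ioc (a ^ (T + n)) (a ^ (T + n + lam + 1))} =
            (E n) ^ k := by
          simp only [hE]
          rw [← Real.rpow_natCast, ← Real.rpow_mul measureReal_nonneg,
            one_div_mul_cancel hk0.ne', Real.rpow_one]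
        rw [e3, ← mul_pow]
        apply pow_le_pow_left₀ (mul_nonneg hD.le (hE0 n))
        simp only [hR]
        have : 0 < η * (1 / 2 : ℝ) ^ (n + 1) := by positivity
        linarith)
      refine ⟨z, ?_, ?_⟩
      · rw [Finset.sum_range_succ]
        have h1 := dist_triangle x y z
        have h2 : dist y z < R n := by rw [dist_comm]; exact hz
        linarith
      · push_cast
        rwa [← add_assoc]
  have hK : closedBall x (D * B + η) ⊆ Ω := by
    intro z hz
    apply aux_ball hk hΩb hx
    rw [dist_comm]
    exact lt_of_le_of_lt hz hlt
  have hbdd := (hu.1.mono hK).bddAbove_of_isCompact (isCompact_closedBall _ _)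
  obtain ⟨M, hM⟩ := hbdd
  obtain ⟨N, hN⟩ := pow_unbounded_of_one_lt (M / a ^ (T + lam)) ha
  obtain ⟨y, hy, huy⟩ := hchain N
  have h1 : u y ≤ M := hM ⟨y, by rw [mem_closedBall, dist_comm]; exact hy.trans (hRsum N), rfl⟩
  rw [div_lt_iff₀ (Real.rpow_pos_of_pos ha0 _)] at hN
  rw [Real.rpow_add ha0, Real.rpow_natCast] at huy
  linarith

/-- Theorem 4.4, quantitative version of Domar's Theorem A:
M(x) ≤ a^{φ⁻(dist(x,∂Ω)/D)}.  (The bound on the supremum M(x) is expressed by bounding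
u(x) for every competitor u in the class C_F.) -/
theorem stmt_14 {k : ℕ} (hk : 2 ≤ k)
    (Ω : Set (EuclideanSpace ℝ (Fin k))) (hΩo : IsOpen Ω) (hΩb : Bornology.IsBounded Ω)
    (F : EuclideanSpace ℝ (Fin k) → EReal) (hF : UpperSemicontinuousOn F Ω)
    (hF0 : ∀ x ∈ Ω, 0 ≤ F x)
    (a : ℝ) (ha : 1 < a)
    (ε : ℝ) (hε : 0 < ε)
    (hInt : ∫⁻ x in Ω, logaPlusPow a ((k : ℝ) - 1 + ε) (F x) < ⊤)
    (hFpos : ∀ s : ℝ, 0 < s → 0 < volume {x ∈ Ω | (s : EReal) < F x})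
    (D : ℝ) (hD : 0 < D) (lam : ℕ) (hlam : 0 < lam)
    (hDlam : a / (D ^ k * unitBallVol k) + a ^ (-(lam : ℝ)) ≤ 1)
    (f₁ : ℝ → ℝ)
    (hf₁ : ∀ t : ℝ, f₁ t = (volume {x ∈ Ω | ((a ^ t : ℝ) : EReal) < F x}).toReal)
    (φ : ℝ → ℝ)
    (hφ : ∀ t : ℝ, φ t =
      ((lam + 1) * (((k : ℝ) - 1) / ε) ^ (((k : ℝ) - 1) / k) * (t - 1 - lam) ^ (-(ε / k))) *
      ((∫ s in Set.Ioi ((t - lam) ^ ((k : ℝ) - 1 + ε)), f₁ (s ^ (1 / ((k : ℝ) - 1 + ε)))) +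
        (t - lam) ^ ((k : ℝ) - 1 + ε) * f₁ (t - lam)) ^ (1 / (k : ℝ)))
    (φinv : ℝ → ℝ)
    (hφinv : ∀ s : ℝ, φinv s = sInf {t : ℝ | (lam : ℝ) + 1 < t ∧ φ t ≤ s}) :
    ∀ x ∈ Ω, ∀ u : EuclideanSpace ℝ (Fin k) → ℝ, SubharmonicOn u Ω →
      (∀ z ∈ Ω, (u z : EReal) ≤ F z) →
      u x ≤ a ^ (φinv (Metric.infDist x (frontier Ω) / D)) := by
  intro x hx u hu huF
  have ha0 : 0 < a := by linarith
  have hk2 : (2 : ℝ) ≤ k := by exact_mod_cast hk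
  have hk0 : (0 : ℝ) < k := by linarith
  have hp0 : 0 < (k : ℝ) - 1 + ε := by linarith
  have hfin : ∀ P : EuclideanSpace ℝ (Fin k) → Prop, volume {z ∈ Ω | P z} ≠ ⊤ := fun P =>
    ((measure_mono (fun z hz => hz.1)).trans_lt hΩb.measure_lt_top).ne
  have hanti : Antitone f₁ := by
    intro s t hst
    rw [hf₁, hf₁]
    refine ENNReal.toReal_mono (hfin _) (measure_mono fun z hz => ⟨hz.1, lt_of_le_of_lt ?_ hz.2⟩)
    exact_mod_cast Real.rpow_le_rpow_of_exponent_le ha.le hst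
  have hf0 : ∀ t, 0 < f₁ t := fun t => by
    rw [hf₁]
    exact ENNReal.toReal_pos (hFpos _ (Real.rpow_pos_of_pos ha0 t)).ne' (hfin _)
  have hint := aux_integrable hk hΩo hΩb hF ha hp0 hInt hanti hf₁
  set p := (k : ℝ) - 1 + ε with hp
  set d := infDist x (frontier Ω) with hd
  have hd0 : 0 < d := aux_pos hk hΩo hΩb hx
  set I : ℝ → ℝ := fun T => (∫ s in Set.Ioi (T ^ p), f₁ (s ^ (1 / p))) + T ^ p * f₁ T with hI
  have hIanti : ∀ T T', 0 < T → T ≤ T' → I T' ≤ I T := fun T T' h0 h1 =>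
    aux_I_anti hanti (fun t => (hf0 t).le) hp0 hint h0 h1
  have hIpos : ∀ T, 0 < T → 0 < I T := by
    intro T hT
    have h1 : 0 ≤ ∫ s in Set.Ioi (T ^ p), f₁ (s ^ (1 / p)) :=
      integral_nonneg fun s => (hf0 _).le
    have h2 : 0 < T ^ p * f₁ T := mul_pos (Real.rpow_pos_of_pos hT _) (hf0 T)
    simp only [hI]
    linarith
  set C : ℝ := (lam + 1) * (((k : ℝ) - 1) / ε) ^ (((k : ℝ) - 1) / k) with hC
  have hC0 : 0 < C := by
    have : 0 < ((k : ℝ) - 1) / ε := div_pos (by linarith) hε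
    positivity
  have hφ' : ∀ t, φ t = C * (t - 1 - lam) ^ (-(ε / k)) * (I (t - lam)) ^ (1 / (k : ℝ)) :=
    fun t => hφ t
  have hlamr : (0 : ℝ) < lam := by exact_mod_cast hlam
  -- the key claim with strict inequality
  have hkey : ∀ t, (lam : ℝ) + 1 < t → φ t < d / D → u x ≤ a ^ t := by
    intro t ht htd
    have hT : 1 < t - lam := by linarith
    have h1 := aux_chain hk hΩo hΩb ha hD hDlam hu hx (T := t - lam) (B := φ t)
      (fun N => by
        have := aux_sum hk hΩo hΩb ha hε hanti hf₁ hint hu.1 huF lam hT N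
        rw [hφ]
        rw [show t - 1 - (lam : ℝ) = t - lam - 1 by ring]
        exact this)
      (by rw [lt_div_iff₀ hD] at htd; linarith)
    rwa [sub_add_cancel] at h1
  have hmono : ∀ t t', (lam : ℝ) + 1 < t → t < t' → φ t' < φ t := by
    intro t t' ht htt
    rw [hφ', hφ']
    have h1 : (t' - 1 - lam) ^ (-(ε / k)) < (t - 1 - lam) ^ (-(ε / k)) :=
      Real.rpow_lt_rpow_of_neg (by linarith) (by linarith) (by
        have : 0 < ε / k := by positivity
        linarith)
    have h2 : (I (t' - lam)) ^ (1 / (k : ℝ)) ≤ (I (t - lam)) ^ (1 / (k : ℝ)) :=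
      Real.rpow_le_rpow (hIpos _ (by linarith)).le (hIanti _ _ (by linarith) (by linarith))
        (by positivity)
    have h3 : 0 < (I (t - lam)) ^ (1 / (k : ℝ)) := Real.rpow_pos_of_pos (hIpos _ (by linarith)) _
    have h4 : 0 < (t' - 1 - lam) ^ (-(ε / k)) := Real.rpow_pos_of_pos (by linarith) _
    calc _ ≤ C * (t' - 1 - lam) ^ (-(ε / k)) * (I (t - lam)) ^ (1 / (k : ℝ)) := by gcongr
      _ < _ := by gcongr
  have hne : ({t : ℝ | (lam : ℝ) + 1 < t ∧ φ t ≤ d / D}).Nonempty := by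
    have hlim : Tendsto (fun t : ℝ => C * (t - 1 - lam) ^ (-(ε / k)) *
        (I 2) ^ (1 / (k : ℝ))) atTop (nhds (C * 0 * (I 2) ^ (1 / (k : ℝ)))) := by
      refine Tendsto.mul_const _ (Tendsto.const_mul _ ?_)
      have h1 : Tendsto (fun t : ℝ => t - 1 - lam) atTop atTop := by
        have := tendsto_atTop_add_const_right atTop (-1 - (lam : ℝ)) (tendsto_id (α := ℝ))
        refine this.congr fun t => ?_
        simp only [id]; ring
      exact (tendsto_rpow_neg_atTop (by positivity)).comp h1
    rw [mul_zero, zero_mul] at hlim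
    have hev := hlim.eventually (gt_mem_nhds (div_pos hd0 hD))
    obtain ⟨t, h1, h2⟩ := (hev.and (eventually_ge_atTop ((lam : ℝ) + 2))).exists
    refine ⟨t, by linarith, ?_⟩
    rw [hφ']
    refine le_trans ?_ h1.le
    have h3 : (I (t - lam)) ^ (1 / (k : ℝ)) ≤ (I 2) ^ (1 / (k : ℝ)) :=
      Real.rpow_le_rpow (hIpos _ (by linarith)).le (hIanti _ _ (by norm_num) (by linarith))
        (by positivity)
    have h4 : 0 < (t - 1 - lam) ^ (-(ε / k)) := Real.rpow_pos_of_pos (by linarith) _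
    gcongr
  rw [hφinv]
  -- conclude by approximation
  have hgt : ∀ τ, sInf {t : ℝ | (lam : ℝ) + 1 < t ∧ φ t ≤ d / D} < τ → u x ≤ a ^ τ := by
    intro τ hτ
    obtain ⟨t, ⟨ht1, ht2⟩, htτ⟩ := exists_lt_of_csInf_lt hne hτ
    exact hkey τ (by linarith) ((hmono t τ ht1 htτ).trans_le ht2)
  have hcont : Tendsto (fun τ : ℝ => a ^ τ)
      (nhdsWithin (sInf {t : ℝ | (lam : ℝ) + 1 < t ∧ φ t ≤ d / D})
        (Ioi (sInf {t : ℝ | (lam : ℝ) + 1 < t ∧ φ t ≤ d / D})))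
      (nhds (a ^ sInf {t : ℝ | (lam : ℝ) + 1 < t ∧ φ t ≤ d / D})) :=
    ((Real.continuous_const_rpow ha0.ne').tendsto _).mono_left nhdsWithin_le_nhds
  refine ge_of_tendsto hcont ?_
  filter_upwards [self_mem_nhdsWithin] with τ hτ using hgt τ hτ
end
end
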